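/- Assume k is generic. Then for every λ ∈ Λ there exists a unique S_N-invariant Laurent polynomial E_λ in the variables t_1,…,t_N (the normalized symmetric Macdonald polynomial of degree λ) such that E_λ(k^δ) = 1 and L_i E_λ = e_i(q^{−λ} k^δ) · E_λ for every 1 ≤ i ≤ N, the eigenvalue equations being identities of rational functions in t_1,…,t_N. -/

import Mathlib

/-- Evaluation of the Laurent polynomial with (finitely supported) coefficient function `c`
at the point `t ∈ (ℂ∖{0})^N`: `∑_ν c_ν t^ν`. -/
noncomputable def evalL (N : ℕ) (c : (Fin N → ℤ) →₀ ℂ) (t : Fin N → ℂ) : ℂ :=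
  ∑ ν ∈ c.support, c ν * ∏ i, t i ^ ν i

/-- `δ = (N-1, N-3, …, 1-N)`, i.e. `δ_i = N + 1 - 2i` in 1-based labels
(`N - 1 - 2i` in 0-based labels). -/
def deltaVec (N : ℕ) (i : Fin N) : ℤ := (N : ℤ) - 1 - 2 * (i : ℕ)

/-- `ϖ_j = (1, …, 1, 0, …, 0)` (`j` ones). -/
def varpi (N j : ℕ) (r : Fin N) : ℤ := if (r : ℕ) < j then 1 else 0

/-- `k` is generic: `k^{2j} ∉ q^ℤ` for `1 ≤ j ≤ N`, and
`k^{⟨δ, ϖ_j - w(ϖ_j)⟩} ∉ q^ℤ` for `1 ≤ j ≤ N-1` and `w ∈ S_N` with `w(ϖ_j) ≠ ϖ_j`,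
where `S_N` acts on `ℤ^N` by `(wμ)_r = μ_{w⁻¹(r)}`. -/
def IsGeneric (N : ℕ) (q : ℝ) (k : ℂ) : Prop :=
  (∀ j : ℕ, 1 ≤ j → j ≤ N → ∀ m : ℤ, k ^ (2 * j) ≠ (q : ℂ) ^ m) ∧
  (∀ j : ℕ, 1 ≤ j → j ≤ N - 1 → ∀ w : Equiv.Perm (Fin N),
    (fun r : Fin N => varpi N j (w⁻¹ r)) ≠ varpi N j →
    ∀ m : ℤ,
      k ^ (∑ r : Fin N, deltaVec N r * (varpi N j r - varpi N j (w⁻¹ r))) ≠ (q : ℂ) ^ m)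

section Auxiliary

open Finset

/-- A commuting family of endomorphisms of a finite-dimensional space which has a joint
eigenfunctional also has a joint eigenvector with the same eigenvalues. -/
theorem exists_joint_eigenvector {ι V : Type*} [Finite ι] [AddCommGroup V] [Module ℂ V]
    [FiniteDimensional ℂ V] (L : ι → Module.End ℂ V) (hL : ∀ i j, Commute (L i) (L j))
    (ℓ : Module.Dual ℂ V) (hℓ : ℓ ≠ 0) (e : ι → ℂ) (he : ∀ i v, ℓ (L i v) = e i * ℓ v) :
    ∃ v : V, v ≠ 0 ∧ ∀ i, L i v = e i • v := by
  classical
  have htop := Module.End.iSup_iInf_maxGenEigenspace_eq_top_of_iSup_maxGenEigenspace_eq_top_of_commute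
    L (fun i j _ => hL i j) (fun i => Module.End.iSup_maxGenEigenspace_eq_top (L i))
  have hpow : ∀ (i : ι) (c : ℂ) (n : ℕ) (v : V),
      ℓ (((L i - algebraMap ℂ (Module.End ℂ V) c) ^ n) v) = (e i - c) ^ n * ℓ v := by
    intro i c n
    induction n with
    | zero => intro v; simp
    | succ n ih =>
      intro v
      rw [pow_succ, Module.End.mul_apply, ih]
      simp [he, Module.algebraMap_end_apply]
      ring
  obtain ⟨χ, x, hx, hℓx⟩ : ∃ χ : ι → ℂ, ∃ x ∈ ⨅ i, (L i).maxGenEigenspace (χ i), ℓ x ≠ 0 := by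
    by_contra! h
    apply hℓ
    rw [← LinearMap.ker_eq_top, eq_top_iff, ← htop, iSup_le_iff]
    exact fun χ x hx => h χ x hx
  have hnil : ∀ i, ∃ n : ℕ, ((L i - algebraMap ℂ (Module.End ℂ V) (e i)) ^ n) x = 0 := by
    intro i
    obtain ⟨n, hn⟩ := (Module.End.mem_iInf_maxGenEigenspace_iff _ _ _).mp hx i
    have h0 := hpow i (χ i) n x
    have hn' : ((L i - algebraMap ℂ (Module.End ℂ V) (χ i)) ^ n) x = 0 := hn
    rw [hn', map_zero] at h0
    have : e i = χ i := by
      by_contra h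
      exact mul_ne_zero (pow_ne_zero n (sub_ne_zero.mpr h)) hℓx h0.symm
    exact ⟨n, this ▸ hn'⟩
  set T : ι → Module.End ℂ V := fun i => L i - algebraMap ℂ (Module.End ℂ V) (e i) with hT
  have hTc : ∀ i j, Commute (T i) (T j) := fun i j =>
    ((hL i j).sub_right (Algebra.commutes (e j) (L i)).symm).sub_left
      (Algebra.commutes (e i) (T j))
  have key : ∀ s : Finset ι, ∃ y : V, y ≠ 0 ∧ (∀ i, ∃ n : ℕ, (T i ^ n) y = 0) ∧
      ∀ i ∈ s, T i y = 0 := by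
    intro s
    induction s using Finset.induction_on with
    | empty => exact ⟨x, fun h => hℓx (by rw [h, map_zero]), hnil, by simp⟩
    | insert j s _ ih =>
      obtain ⟨y, hy0, hyn, hys⟩ := ih
      have hex := hyn j
      have hpos : Nat.find hex ≠ 0 := by
        intro h
        have := Nat.find_spec hex
        rw [h] at this
        exact hy0 this
      obtain ⟨m, hm⟩ := Nat.exists_eq_succ_of_ne_zero hpos
      have hcomm : ∀ i n (z : V), (T i ^ n) ((T j ^ m) z) = (T j ^ m) ((T i ^ n) z) := by
        intro i n z
        rw [← Module.End.mul_apply, ← Module.End.mul_apply, ((hTc i j).pow_pow n m).eq]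
      refine ⟨(T j ^ m) y, Nat.find_min hex (by omega), fun i => ?_, fun i hi => ?_⟩
      · obtain ⟨n, hn⟩ := hyn i
        exact ⟨n, by rw [hcomm, hn, map_zero]⟩
      · rcases Finset.mem_insert.mp hi with rfl | hi
        · rw [← Module.End.mul_apply, ← pow_succ', ← Nat.succ_eq_add_one, ← hm]
          exact Nat.find_spec hex
        · have := hcomm i 1 y
          rw [pow_one] at this
          rw [this, hys i hi, map_zero]
  cases nonempty_fintype ι
  obtain ⟨y, hy0, -, hy⟩ := key Finset.univ
  refine ⟨y, hy0, fun i => ?_⟩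
  have := hy i (Finset.mem_univ i)
  simpa [hT, Module.algebraMap_end_apply, sub_eq_zero] using this

section PairSum

variable {ι R : Type*} [DecidableEq ι] [CommRing R]

/-- The sum over the subsets `I` of `M` of `c #I * ∏_{r ∈ I, s ∈ M \ I} φ r s`. -/
def pairSum (φ : ι → ι → R) (c : ℕ → R) (M : Finset ι) : R :=
  ∑ I ∈ M.powerset, c #I * ∏ r ∈ I, ∏ s ∈ M \ I, φ r s

/-- The numerator of `pairSum` on `insert m M`, viewed as a function of the variable at `m`:
`Q` is the common denominator, `A` and `B` are the numerators of `φ m ·` and `φ · m`. -/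
def insertSum (A B Q : ι → R) (c : ℕ → R) (w : Finset ι → R) (M : Finset ι) : R :=
  ∑ I ∈ M.powerset, (c #I * ((∏ r ∈ I, B r) * ∏ s ∈ M \ I, Q s) +
    c (#I + 1) * ((∏ s ∈ M \ I, A s) * ∏ r ∈ I, Q r)) * w I

theorem pairSum_insert (φ : ι → ι → R) (c : ℕ → R) {M : Finset ι} {m : ι} (hm : m ∉ M) :
    pairSum φ c (insert m M) =
      insertSum (φ m) (fun r => φ r m) 1 c (fun I => ∏ r ∈ I, ∏ s ∈ M \ I, φ r s) M := by
  unfold pairSum insertSum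
  rw [sum_powerset_insert hm, ← sum_add_distrib]
  refine sum_congr rfl fun I hI => ?_
  have hI' := mem_powerset.mp hI
  have hmI : m ∉ I := fun h => hm (hI' h)
  have h1 : insert m M \ I = insert m (M \ I) := insert_sdiff_of_notMem _ hmI
  have h2 : insert m M \ insert m I = M \ I := by
    rw [insert_sdiff_insert, sdiff_insert_of_notMem hm]
  have hm' : m ∉ M \ I := fun h => hm (mem_sdiff.mp h).1
  rw [h1, h2, prod_insert hmI, card_insert_of_notMem hmI]
  simp only [prod_insert hm', prod_mul_distrib, Pi.one_apply, prod_const_one]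
  ring

theorem insertSum_mul (A B Q : ι → R) (c : ℕ → R) (w : Finset ι → R) (M : Finset ι) :
    insertSum (fun s => A s * Q s) (fun s => B s * Q s) Q c w M =
      (∏ s ∈ M, Q s) * insertSum A B 1 c w M := by
  unfold insertSum
  rw [mul_sum]
  refine sum_congr rfl fun I hI => ?_
  rw [← prod_sdiff (mem_powerset.mp hI)]
  simp only [prod_mul_distrib, Pi.one_apply, prod_const_one]
  ring

theorem insertSum_congr {A B Q A' B' Q' : ι → R} {M : Finset ι} (hA : ∀ s ∈ M, A s = A' s)
    (hB : ∀ s ∈ M, B s = B' s) (hQ : ∀ s ∈ M, Q s = Q' s) (c : ℕ → R) (w : Finset ι → R) :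
    insertSum A B Q c w M = insertSum A' B' Q' c w M := by
  unfold insertSum
  refine sum_congr rfl fun I hI => ?_
  have hI' := mem_powerset.mp hI
  rw [prod_congr rfl fun s hs => hB s (hI' hs), prod_congr rfl fun s hs => hQ s (hI' hs),
    prod_congr rfl fun s hs => hA s (mem_sdiff.mp hs).1,
    prod_congr rfl fun s hs => hQ s (mem_sdiff.mp hs).1]

theorem insertSum_one (c : ℕ → R) (φ : ι → ι → R) (M : Finset ι) :
    insertSum 1 1 1 c (fun I => ∏ r ∈ I, ∏ s ∈ M \ I, φ r s) M =
      pairSum φ (fun n => c n + c (n + 1)) M := by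
  simp [insertSum, pairSum]

/-- When the common denominator vanishes at `j`, only half of the terms survive. -/
theorem insertSum_insert_of_eq_zero (A B Q a b : ι → R) (c : ℕ → R) (φ : ι → ι → R)
    {M : Finset ι} {j : ι} (hj : j ∉ M) (hQ : Q j = 0) (hA : ∀ s ∈ M, A s = a s * Q s)
    (hB : ∀ s ∈ M, B s = b s * Q s) :
    insertSum A B Q c (fun I => ∏ r ∈ I, ∏ s ∈ insert j M \ I, φ r s) (insert j M) =
      (∏ s ∈ M, Q s) * ∑ I ∈ M.powerset, c (#I + 1) *
        (B j * ((∏ r ∈ I, b r) * ∏ s ∈ M \ I, φ j s) +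
          A j * ((∏ s ∈ M \ I, a s) * ∏ r ∈ I, φ r j)) * ∏ r ∈ I, ∏ s ∈ M \ I, φ r s := by
  unfold insertSum
  rw [sum_powerset_insert hj, ← sum_add_distrib, mul_sum]
  refine sum_congr rfl fun I hI => ?_
  have hI' := mem_powerset.mp hI
  have hjI : j ∉ I := fun h => hj (hI' h)
  have h1 : insert j M \ I = insert j (M \ I) := insert_sdiff_of_notMem _ hjI
  have h2 : insert j M \ insert j I = M \ I := by
    rw [insert_sdiff_insert, sdiff_insert_of_notMem hj]
  have hj' : j ∉ M \ I := fun h => hj (mem_sdiff.mp h).1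
  have hAI : ∏ s ∈ M \ I, A s = (∏ s ∈ M \ I, a s) * ∏ s ∈ M \ I, Q s := by
    rw [← prod_mul_distrib]
    exact prod_congr rfl fun s hs => hA s (mem_sdiff.mp hs).1
  have hBI : ∏ s ∈ I, B s = (∏ s ∈ I, b s) * ∏ s ∈ I, Q s := by
    rw [← prod_mul_distrib]
    exact prod_congr rfl fun s hs => hB s (hI' hs)
  simp only [h1, h2, card_insert_of_notMem hjI, ← prod_sdiff hI', prod_insert hj',
    prod_insert hjI, prod_mul_distrib, hQ, hAI, hBI]
  ring

end PairSum

section Polynomial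
open Polynomial

theorem natDegree_insertSum_le {ι : Type*} [DecidableEq ι] (A B Q : ι → ℂ[X]) (d : ℕ)
    (hA : ∀ s, (A s).natDegree ≤ d) (hB : ∀ s, (B s).natDegree ≤ d)
    (hQ : ∀ s, (Q s).natDegree ≤ d) (c : ℕ → ℂ) (w : Finset ι → ℂ) (M : Finset ι) :
    (insertSum A B Q (fun n => C (c n)) (fun I => C (w I)) M).natDegree ≤ d * #M := by
  have hprod : ∀ (F G : ι → ℂ[X]), (∀ s, (F s).natDegree ≤ d) → (∀ s, (G s).natDegree ≤ d) →
      ∀ I ⊆ M, ((∏ s ∈ I, F s) * ∏ s ∈ M \ I, G s).natDegree ≤ d * #M := by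
    intro F G hF hG I hI
    refine natDegree_mul_le.trans ?_
    have h1 := (natDegree_prod_le I F).trans (sum_le_card_nsmul I _ d fun s _ => hF s)
    have h2 := (natDegree_prod_le (M \ I) G).trans
      (sum_le_card_nsmul (M \ I) _ d fun s _ => hG s)
    rw [← card_sdiff_add_card_eq_card hI]
    simp only [smul_eq_mul] at h1 h2
    linarith [mul_comm d (#(M \ I) + #I), mul_comm (#I) d, mul_add d (#(M \ I)) (#I),
      mul_comm (#(M \ I)) d]
  refine natDegree_sum_le_of_forall_le _ _ fun I hI => ?_
  have hI' := mem_powerset.mp hI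
  refine (natDegree_mul_C_le _ _).trans (natDegree_add_le_of_degree_le ?_ ?_)
  · exact (natDegree_C_mul_le _ _).trans (hprod _ _ hB hQ I hI')
  · refine (natDegree_C_mul_le _ _).trans ?_
    rw [mul_comm]
    exact hprod _ _ hQ hA I hI'

theorem eval_insertSum {ι : Type*} [DecidableEq ι] (A B Q : ι → ℂ[X]) (c : ℕ → ℂ)
    (w : Finset ι → ℂ) (M : Finset ι) (z : ℂ) :
    (insertSum A B Q (fun n => C (c n)) (fun I => C (w I)) M).eval z =
      insertSum (fun s => (A s).eval z) (fun s => (B s).eval z) (fun s => (Q s).eval z) c w M := by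
  simp [insertSum, eval_finsetSum, eval_prod]

end Polynomial

section Ruijsenaars
open Polynomial

/-- The coupling between two variables when two `q`-difference operators are composed. -/
noncomputable def coupling (k p x y : ℂ) : ℂ :=
  (k * x - k⁻¹ * y) * (k * y - k⁻¹ * (p * x)) / ((x - y) * (y - p * x))

variable {k p : ℂ}

theorem coupling_inv_mul (hp : p ≠ 0) (x y : ℂ) :
    coupling k p (p⁻¹ * y) x = coupling k p x y := by
  unfold coupling
  rw [show p * (p⁻¹ * y) = y by field_simp,
    show k * (p⁻¹ * y) - k⁻¹ * x = p⁻¹ * (k * y - k⁻¹ * (p * x)) by field_simp,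
    show p⁻¹ * y - x = p⁻¹ * (y - p * x) by field_simp]
  rw [show p⁻¹ * (k * y - k⁻¹ * (p * x)) * (k * x - k⁻¹ * y) =
      p⁻¹ * ((k * x - k⁻¹ * y) * (k * y - k⁻¹ * (p * x))) by ring,
    show p⁻¹ * (y - p * x) * (x - y) = p⁻¹ * ((x - y) * (y - p * x)) by ring,
    mul_div_mul_left _ _ (inv_ne_zero hp)]

theorem coupling_mul (hp : p ≠ 0) (x y : ℂ) :
    coupling k p x (p * y) = coupling k p y x := by
  rw [← coupling_inv_mul hp x (p * y), inv_mul_cancel_left₀ hp]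

theorem coupling_zero_left (hk : k ≠ 0) {y : ℂ} (hy : y ≠ 0) : coupling k p 0 y = 1 := by
  rw [coupling, div_eq_one_iff_eq (by simp [hy])]
  field_simp
  ring

theorem coupling_zero_right (hk : k ≠ 0) (hp : p ≠ 0) {x : ℂ} (hx : x ≠ 0) :
    coupling k p x 0 = 1 := by
  unfold coupling
  field_simp
  ring

/-- Genericity of the variables in `M`: no two of them are related by a small power of `p`. -/
def GenericOn {ι : Type*} (p : ℂ) (x : ι → ℂ) (M : Finset ι) : Prop :=
  (∀ r ∈ M, x r ≠ 0) ∧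
    ∀ r ∈ M, ∀ s ∈ M, r ≠ s → x r ≠ x s ∧ x r ≠ p * x s ∧ x r ≠ p ^ 2 * x s

theorem GenericOn.mono {ι : Type*} {x : ι → ℂ} {M M' : Finset ι} (h : GenericOn p x M)
    (hM : M' ⊆ M) : GenericOn p x M' :=
  ⟨fun r hr => h.1 r (hM hr), fun r hr s hs => h.2 r (hM hr) s (hM hs)⟩

/-- The points at which the numerator polynomial is shown to vanish are pairwise distinct. -/
theorem card_special_points {ι : Type*} {x : ι → ℂ} {M : Finset ι} (hp : p ≠ 0) (hp1 : p ≠ 1)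
    (hp2 : p ^ 2 ≠ 1) (hx : GenericOn p x M) :
    3 * #M < #(insert 0 (M.image x ∪ M.image (fun s => p⁻¹ * x s) ∪
      M.image (fun s => p * x s))) := by
  classical
  have hinj : Set.InjOn x M := by
    intro r hr s hs h
    by_contra hrs
    exact (hx.2 r hr s hs hrs).1 h
  have h1 : #(M.image x) = #M := card_image_of_injOn hinj
  have h2 : #(M.image fun s => p⁻¹ * x s) = #M :=
    card_image_of_injOn fun r hr s hs h =>
      hinj hr hs (mul_left_cancel₀ (inv_ne_zero hp) h)
  have h3 : #(M.image fun s => p * x s) = #M :=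
    card_image_of_injOn fun r hr s hs h => hinj hr hs (mul_left_cancel₀ hp h)
  have ha : ∀ r ∈ M, ∀ s ∈ M, x r ≠ p * x s := by
    intro r hr s hs h
    by_cases hrs : r = s
    · subst hrs
      exact hp1 (mul_right_cancel₀ (hx.1 r hr) (by rw [← h, one_mul]))
    · exact (hx.2 r hr s hs hrs).2.1 h
  have hb : ∀ r ∈ M, ∀ s ∈ M, x r ≠ p ^ 2 * x s := by
    intro r hr s hs h
    by_cases hrs : r = s
    · subst hrs
      exact hp2 (mul_right_cancel₀ (hx.1 r hr) (by rw [← h, one_mul]))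
    · exact (hx.2 r hr s hs hrs).2.2 h
  have hd1 : Disjoint (M.image x) (M.image fun s => p⁻¹ * x s) := by
    simp only [disjoint_left, mem_image, not_exists, not_and]
    rintro _ ⟨r, hr, rfl⟩ s hs h
    exact ha s hs r hr (by rw [← h, mul_inv_cancel_left₀ hp])
  have hd2 : Disjoint (M.image x ∪ M.image fun s => p⁻¹ * x s) (M.image fun s => p * x s) := by
    rw [disjoint_union_left]
    simp only [disjoint_left, mem_image, not_exists, not_and]
    refine ⟨?_, ?_⟩
    · rintro _ ⟨r, hr, rfl⟩ s hs h
      exact ha r hr s hs h.symm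
    · rintro _ ⟨r, hr, rfl⟩ s hs h
      exact hb r hr s hs (by rw [pow_two, mul_assoc, h, mul_inv_cancel_left₀ hp])
  rw [card_insert_of_notMem, card_union_of_disjoint hd2, card_union_of_disjoint hd1, h1, h2, h3]
  · omega
  · simp only [mem_union, mem_image, not_or, not_exists, not_and]
    refine ⟨⟨fun r hr => hx.1 r hr, fun r hr => mul_ne_zero (inv_ne_zero hp) (hx.1 r hr)⟩,
      fun r hr => mul_ne_zero hp (hx.1 r hr)⟩

/-- The polynomial identity behind the commutativity of the Ruijsenaars operators. -/
theorem pairSum_coupling_comm {ι : Type*} [DecidableEq ι] (hk : k ≠ 0) (hp : p ≠ 0)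
    (hp1 : p ≠ 1) (hp2 : p ^ 2 ≠ 1) (x : ι → ℂ) (M : Finset ι) (hx : GenericOn p x M)
    (c : ℕ → ℂ) :
    pairSum (fun r s => coupling k p (x r) (x s)) c M =
      pairSum (fun r s => coupling k p (x s) (x r)) c M := by
  induction M using Finset.strongInduction generalizing c with
  | H M ih =>
  rcases M.eq_empty_or_nonempty with rfl | ⟨m, hm⟩
  · simp [pairSum]
  obtain ⟨M, hmM, rfl⟩ : ∃ M', m ∉ M' ∧ insert m M' = M :=
    ⟨M.erase m, notMem_erase m M, insert_erase hm⟩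
  have hxM : GenericOn p x M := hx.mono (subset_insert m M)
  have ihM := ih M (ssubset_insert hmM) hxM
  -- the three numerators and denominators, as polynomials in the variable attached to `m`
  let A : ι → ℂ[X] := fun s => (C k * X - C (k⁻¹ * x s)) * (C (k * x s) - C (k⁻¹ * p) * X) *
    (X - C (p * x s))
  let B : ι → ℂ[X] := fun s => (C (k * x s) - C k⁻¹ * X) * (C k * X - C (k⁻¹ * (p * x s))) *
    (C p * X - C (x s))
  let Q : ι → ℂ[X] := fun s => (X - C (x s)) * (C (x s) - C p * X) * (X - C (p * x s))
  have hAe : ∀ s z, (A s).eval z =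
      (k * z - k⁻¹ * x s) * (k * x s - k⁻¹ * (p * z)) * (z - p * x s) := by
    intro s z; simp only [A, eval_mul, eval_sub, eval_C, eval_X]; ring
  have hBe : ∀ s z, (B s).eval z =
      (k * x s - k⁻¹ * z) * (k * z - k⁻¹ * (p * x s)) * (p * z - x s) := by
    intro s z; simp [B]
  have hQe : ∀ s z, (Q s).eval z = (z - x s) * (x s - p * z) * (z - p * x s) := by
    intro s z; simp [Q]
  have hAQ : ∀ s z, (Q s).eval z ≠ 0 → (A s).eval z = coupling k p z (x s) * (Q s).eval z := by
    intro s z h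
    rw [hQe] at h
    have h1 : z - x s ≠ 0 := fun h' => h (by rw [h']; ring)
    have h2 : x s - p * z ≠ 0 := fun h' => h (by rw [h']; ring)
    rw [hAe, hQe, coupling, div_mul_eq_mul_div, eq_div_iff (mul_ne_zero h1 h2)]
    ring
  have hBQ : ∀ s z, (Q s).eval z ≠ 0 → (B s).eval z = coupling k p (x s) z * (Q s).eval z := by
    intro s z h
    rw [hQe] at h
    have h1 : x s - z ≠ 0 := fun h' => h (by rw [← neg_sub, h']; ring)
    have h2 : z - p * x s ≠ 0 := fun h' => h (by rw [h']; ring)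
    rw [hBe, hQe, coupling, div_mul_eq_mul_div, eq_div_iff (mul_ne_zero h1 h2)]
    ring
  let w : Finset ι → ℂ := fun I => ∏ r ∈ I, ∏ s ∈ M \ I, coupling k p (x r) (x s)
  let w' : Finset ι → ℂ := fun I => ∏ r ∈ I, ∏ s ∈ M \ I, coupling k p (x s) (x r)
  let P : ℂ[X] := insertSum A B Q (fun n => C (c n)) (fun I => C (w I)) M -
    insertSum B A Q (fun n => C (c n)) (fun I => C (w' I)) M
  have hPe : ∀ z, P.eval z =
      insertSum (fun s => (A s).eval z) (fun s => (B s).eval z) (fun s => (Q s).eval z) c w M -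
      insertSum (fun s => (B s).eval z) (fun s => (A s).eval z) (fun s => (Q s).eval z) c w' M := by
    intro z
    rw [eval_sub, eval_insertSum, eval_insertSum]
  have hPQ : ∀ z, (∀ s ∈ M, (Q s).eval z ≠ 0) → P.eval z = (∏ s ∈ M, (Q s).eval z) *
      (insertSum (fun s => coupling k p z (x s)) (fun s => coupling k p (x s) z) 1 c w M -
       insertSum (fun s => coupling k p (x s) z) (fun s => coupling k p z (x s)) 1 c w' M) := by
    intro z hz
    rw [hPe, mul_sub, ← insertSum_mul, ← insertSum_mul]
    congr 1
    · exact insertSum_congr (fun s hs => hAQ s z (hz s hs)) (fun s hs => hBQ s z (hz s hs))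
        (fun _ _ => rfl) _ _
    · exact insertSum_congr (fun s hs => hBQ s z (hz s hs)) (fun s hs => hAQ s z (hz s hs))
        (fun _ _ => rfl) _ _
  have hdeg : P.natDegree ≤ 3 * #M := by
    have hA : ∀ s, (A s).natDegree ≤ 3 := fun s => by simp only [A]; compute_degree
    have hB : ∀ s, (B s).natDegree ≤ 3 := fun s => by simp only [B]; compute_degree
    have hQ : ∀ s, (Q s).natDegree ≤ 3 := fun s => by simp only [Q]; compute_degree
    exact (natDegree_sub_le_of_le (natDegree_insertSum_le A B Q 3 hA hB hQ c w M)
      (natDegree_insertSum_le B A Q 3 hB hA hQ c w' M)).trans (max_self _).le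
  have hzero : P.eval 0 = 0 := by
    have hx0 : ∀ s ∈ M, x s ≠ 0 := hxM.1
    rw [hPQ 0 fun s hs => by
      rw [hQe]
      simp [hx0 s hs, hp]]
    have e1 : insertSum (fun s => coupling k p 0 (x s)) (fun s => coupling k p (x s) 0) 1 c w M =
        insertSum 1 1 1 c w M :=
      insertSum_congr (fun s hs => coupling_zero_left hk (hx0 s hs))
        (fun s hs => coupling_zero_right hk hp (hx0 s hs)) (fun _ _ => rfl) _ _
    have e2 : insertSum (fun s => coupling k p (x s) 0) (fun s => coupling k p 0 (x s)) 1 c w' M =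
        insertSum 1 1 1 c w' M :=
      insertSum_congr (fun s hs => coupling_zero_right hk hp (hx0 s hs))
        (fun s hs => coupling_zero_left hk (hx0 s hs)) (fun _ _ => rfl) _ _
    rw [e1, e2, insertSum_one c (fun r s => coupling k p (x r) (x s)),
      insertSum_one c (fun r s => coupling k p (x s) (x r)), ihM, sub_self, mul_zero]
  have hspecial : ∀ j ∈ M, ∀ z, (Q j).eval z = 0 →
      (∀ s ∈ M, s ≠ j → (Q s).eval z ≠ 0) → ∀ D : ℂ,
      (∀ I ⊆ M.erase j, (B j).eval z * ((∏ r ∈ I, coupling k p (x r) z) *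
          ∏ s ∈ M.erase j \ I, coupling k p (x j) (x s)) +
        (A j).eval z * ((∏ s ∈ M.erase j \ I, coupling k p z (x s)) *
          ∏ r ∈ I, coupling k p (x r) (x j)) = D) →
      (∀ I ⊆ M.erase j, (A j).eval z * ((∏ r ∈ I, coupling k p z (x r)) *
          ∏ s ∈ M.erase j \ I, coupling k p (x s) (x j)) +
        (B j).eval z * ((∏ s ∈ M.erase j \ I, coupling k p (x s) z) *
          ∏ r ∈ I, coupling k p (x j) (x r)) = D) → P.eval z = 0 := by
    intro j hj z hQj hQs D h1 h2
    have hj' : j ∉ M.erase j := notMem_erase j M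
    have ihj := ih (M.erase j) ((erase_subset j M).trans_ssubset
      (ssubset_insert hmM)) (hxM.mono (erase_subset j M)) (fun n => c (n + 1))
    have hQs' : ∀ s ∈ M.erase j, (Q s).eval z ≠ 0 := fun s hs =>
      hQs s (mem_of_mem_erase hs) (ne_of_mem_erase hs)
    have e1 := insertSum_insert_of_eq_zero (fun s => (A s).eval z) (fun s => (B s).eval z)
      (fun s => (Q s).eval z) (fun s => coupling k p z (x s)) (fun s => coupling k p (x s) z) c
      (fun r s => coupling k p (x r) (x s)) hj' hQj (fun s hs => hAQ s z (hQs' s hs))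
      (fun s hs => hBQ s z (hQs' s hs))
    have e2 := insertSum_insert_of_eq_zero (fun s => (B s).eval z) (fun s => (A s).eval z)
      (fun s => (Q s).eval z) (fun s => coupling k p (x s) z) (fun s => coupling k p z (x s)) c
      (fun r s => coupling k p (x s) (x r)) hj' hQj (fun s hs => hBQ s z (hQs' s hs))
      (fun s hs => hAQ s z (hQs' s hs))
    rw [insert_erase hj] at e1 e2
    rw [hPe, e1, e2, ← mul_sub]
    refine mul_eq_zero_of_right _ (sub_eq_zero.mpr ?_)
    have s1 := sum_congr (rfl : (M.erase j).powerset = (M.erase j).powerset) fun I hI =>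
      congrArg (fun d => c (#I + 1) * d *
        ∏ r ∈ I, ∏ s ∈ M.erase j \ I, coupling k p (x r) (x s)) (h1 I (mem_powerset.mp hI))
    have s2 := sum_congr (rfl : (M.erase j).powerset = (M.erase j).powerset) fun I hI =>
      congrArg (fun d => c (#I + 1) * d *
        ∏ r ∈ I, ∏ s ∈ M.erase j \ I, coupling k p (x s) (x r)) (h2 I (mem_powerset.mp hI))
    refine s1.trans (Eq.trans ?_ s2.symm)
    simp only [mul_right_comm _ D, ← sum_mul]
    congr 1
  have hne : ∀ j ∈ M, ∀ s ∈ M, s ≠ j → x j ≠ x s ∧ x j ≠ p * x s ∧ x j ≠ p ^ 2 * x s ∧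
      x s ≠ p * x j ∧ x s ≠ p ^ 2 * x j := fun j hj s hs hsj =>
    ⟨(hxM.2 j hj s hs hsj.symm).1, (hxM.2 j hj s hs hsj.symm).2.1, (hxM.2 j hj s hs hsj.symm).2.2,
      (hxM.2 s hs j hj hsj).2.1, (hxM.2 s hs j hj hsj).2.2⟩
  have hroot1 : ∀ j ∈ M, P.eval (x j) = 0 := by
    intro j hj
    have hAB : (B j).eval (x j) = - (A j).eval (x j) := by
      rw [hAe, hBe]; ring
    refine hspecial j hj _ (by rw [hQe]; ring) (fun s hs hsj => ?_) 0 (fun I _ => ?_)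
      fun I _ => ?_
    · obtain ⟨h1, h2, -, h3, -⟩ := hne j hj s hs hsj
      rw [hQe]
      exact mul_ne_zero (mul_ne_zero (sub_ne_zero.mpr h1) (sub_ne_zero.mpr h3))
        (sub_ne_zero.mpr h2)
    · rw [hAB]; ring
    · rw [hAB]; ring
  have hroot2 : ∀ j ∈ M, P.eval (p⁻¹ * x j) = 0 := by
    intro j hj
    have hB0 : (B j).eval (p⁻¹ * x j) = 0 := by
      rw [hBe, mul_inv_cancel_left₀ hp]; ring
    refine hspecial j hj _ (by rw [hQe, mul_inv_cancel_left₀ hp]; ring) (fun s hs hsj => ?_)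
      ((A j).eval (p⁻¹ * x j) * ∏ s ∈ M.erase j, coupling k p (x s) (x j)) (fun I hI => ?_)
      fun I hI => ?_
    · obtain ⟨h1, h2, h3, -, -⟩ := hne j hj s hs hsj
      rw [hQe, mul_inv_cancel_left₀ hp]
      refine mul_ne_zero (mul_ne_zero (sub_ne_zero.mpr fun h => h2 ?_)
        (sub_ne_zero.mpr h1.symm)) (sub_ne_zero.mpr fun h => h3 ?_)
      · rw [← h, mul_inv_cancel_left₀ hp]
      · rw [pow_two, mul_assoc, ← h, mul_inv_cancel_left₀ hp]
    · simp only [hB0, coupling_inv_mul hp, zero_mul, zero_add, prod_sdiff hI]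
    · simp only [hB0, coupling_inv_mul hp, zero_mul, add_zero]
      rw [mul_comm (∏ r ∈ I, _), prod_sdiff hI]
  have hroot3 : ∀ j ∈ M, P.eval (p * x j) = 0 := by
    intro j hj
    have hA0 : (A j).eval (p * x j) = 0 := by
      rw [hAe]; ring
    refine hspecial j hj _ (by rw [hQe]; ring) (fun s hs hsj => ?_)
      ((B j).eval (p * x j) * ∏ s ∈ M.erase j, coupling k p (x j) (x s)) (fun I hI => ?_)
      fun I hI => ?_
    · obtain ⟨h1, -, -, h2, h3⟩ := hne j hj s hs hsj
      rw [hQe]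
      refine mul_ne_zero (mul_ne_zero (sub_ne_zero.mpr h2.symm) (sub_ne_zero.mpr fun h => h3 ?_))
        (sub_ne_zero.mpr fun h => h1 (mul_left_cancel₀ hp h))
      rw [h]; ring
    · simp only [hA0, coupling_mul hp, zero_mul, add_zero]
      rw [mul_comm (∏ r ∈ I, _), prod_sdiff hI]
    · simp only [hA0, coupling_mul hp, zero_mul, zero_add, prod_sdiff hI]
  have hP0 : P = 0 := by
    refine eq_zero_of_natDegree_lt_card_of_eval_eq_zero' P _ (fun z hz => ?_)
      (hdeg.trans_lt (card_special_points hp hp1 hp2 hxM))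
    simp only [mem_insert, mem_union, mem_image] at hz
    rcases hz with rfl | (⟨j, hj, rfl⟩ | ⟨j, hj, rfl⟩) | ⟨j, hj, rfl⟩
    exacts [hzero, hroot1 j hj, hroot2 j hj, hroot3 j hj]
  have hQm : ∀ s ∈ M, (Q s).eval (x m) ≠ 0 := by
    intro s hs
    have hms : m ≠ s := fun h => hmM (h ▸ hs)
    have h1 := hx.2 m (mem_insert_self m M) s (mem_insert_of_mem hs) hms
    have h2 := hx.2 s (mem_insert_of_mem hs) m (mem_insert_self m M) hms.symm
    rw [hQe]
    exact mul_ne_zero (mul_ne_zero (sub_ne_zero.mpr h1.1) (sub_ne_zero.mpr h2.2.1))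
      (sub_ne_zero.mpr h1.2.1)
  have hfin := hPQ (x m) hQm
  rw [hP0, eval_zero, eq_comm, mul_eq_zero, or_iff_right (prod_ne_zero_iff.mpr hQm),
    sub_eq_zero] at hfin
  rw [pairSum_insert _ _ hmM, pairSum_insert _ _ hmM]
  exact hfin

end Ruijsenaars

section Operators

variable {ι : Type*} [Fintype ι] [DecidableEq ι]

/-- The coefficients of the Ruijsenaars operators. -/
noncomputable def ruijCoeff (k : ℂ) (t : ι → ℂ) (I : Finset ι) : ℂ :=
  ∏ r ∈ I, ∏ s ∈ Iᶜ, (k * t r - k⁻¹ * t s) / (t r - t s)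

/-- Multiplication by `p` of the variables indexed by `I`. -/
def shift (p : ℂ) (I : Finset ι) (t : ι → ℂ) (r : ι) : ℂ := if r ∈ I then p * t r else t r

/-- The `i`-th Ruijsenaars operator, acting on functions of `t`. -/
noncomputable def ruij (k p : ℂ) (i : ℕ) (F : (ι → ℂ) → ℂ) (t : ι → ℂ) : ℂ :=
  ∑ I ∈ powersetCard i univ, ruijCoeff k t I * F (shift p I t)

omit [Fintype ι] in
theorem sum_fiber_inter_union {R : Type*} [CommRing R] (φ : ι → ι → R) (i j : ℕ)
    (S : Finset (Finset ι × Finset ι)) {K U : Finset ι} (hKU : K ⊆ U)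
    (hS : ∀ I J, (I, J) ∈ S ↔ (#I = i ∧ #J = j) ∧ I ∩ J = K ∧ I ∪ J = U) :
    ∑ x ∈ S, ∏ r ∈ x.1 \ x.2, ∏ s ∈ x.2 \ x.1, φ r s =
      pairSum φ (fun n => if #K + n = i ∧ #K + (#(U \ K) - n) = j then 1 else 0) (U \ K) := by
  unfold pairSum
  simp only [ite_mul, one_mul, zero_mul]
  rw [← sum_filter]
  refine sum_bij' (fun x _ => x.1 \ x.2) (fun a _ => (K ∪ a, K ∪ ((U \ K) \ a))) ?_ ?_ ?_ ?_ ?_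
  · rintro ⟨I, J⟩ h
    obtain ⟨⟨rfl, rfl⟩, rfl, rfl⟩ := (hS I J).mp h
    have e1 : (I ∪ J) \ (I ∩ J) = (I \ J) ∪ (J \ I) := by grind
    have e2 : Disjoint (I \ J) (J \ I) := by
      rw [disjoint_left]; grind [mem_compl]
    simp only [mem_filter, mem_powerset, e1, card_union_of_disjoint e2]
    refine ⟨subset_union_left, ?_, ?_⟩
    · rw [add_comm, card_sdiff_add_card_inter]
    · rw [inter_comm, add_tsub_cancel_left, add_comm, card_sdiff_add_card_inter]
  · intro a ha
    simp only [mem_filter, mem_powerset] at ha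
    obtain ⟨ha, h1, h2⟩ := ha
    rw [hS]
    have hd1 : Disjoint K a := by rw [disjoint_left]; grind [mem_compl]
    have hd2 : Disjoint K ((U \ K) \ a) := by rw [disjoint_left]; grind [mem_compl]
    rw [card_union_of_disjoint hd1, card_union_of_disjoint hd2, card_sdiff_of_subset ha]
    refine ⟨⟨h1, h2⟩, ?_, ?_⟩ <;> grind
  · rintro ⟨I, J⟩ h
    obtain ⟨-, rfl, rfl⟩ := (hS I J).mp h
    ext x <;> grind
  · intro a ha
    simp only [mem_filter, mem_powerset] at ha
    ext x
    grind
  · rintro ⟨I, J⟩ h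
    obtain ⟨-, rfl, rfl⟩ := (hS I J).mp h
    refine prod_congr rfl fun r _ => prod_congr ?_ fun _ _ => rfl
    grind

/-- The part of a product of two coefficients that only depends on `K = I ∩ J`
and `U = I ∪ J`. -/
noncomputable def ruijPairCoeff (k p : ℂ) (t : ι → ℂ) (K U : Finset ι) : ℂ :=
  (∏ r ∈ K, ∏ s ∈ Uᶜ, ((k * t r - k⁻¹ * t s) / (t r - t s) *
    ((k * (p * t r) - k⁻¹ * t s) / (p * t r - t s)))) *
  (∏ r ∈ K, ∏ s ∈ U \ K, (k * t r - k⁻¹ * t s) / (t r - t s)) *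
  ∏ r ∈ U \ K, ∏ s ∈ Uᶜ, (k * t r - k⁻¹ * t s) / (t r - t s)

theorem ruijCoeff_mul_ruijCoeff_shift {k p : ℂ} (hp : p ≠ 0) (t : ι → ℂ) (I J : Finset ι) :
    ruijCoeff k t I * ruijCoeff k (shift p I t) J =
      ruijPairCoeff k p t (I ∩ J) (I ∪ J) *
        ∏ r ∈ I \ J, ∏ s ∈ J \ I, coupling k p (t r) (t s) := by
  have hI : I = (I ∩ J) ∪ (I \ J) := by grind
  have hI' : Iᶜ = (J \ I) ∪ (I ∪ J)ᶜ := by ext; grind [mem_compl]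
  have hJ : J = (I ∩ J) ∪ (J \ I) := by grind
  have hJ' : Jᶜ = (I \ J) ∪ (I ∪ J)ᶜ := by ext; grind [mem_compl]
  have hM : (I ∪ J) \ (I ∩ J) = (I \ J) ∪ (J \ I) := by grind
  have d1 : Disjoint (I ∩ J) (I \ J) := by rw [disjoint_left]; grind [mem_compl]
  have d2 : Disjoint (J \ I) (I ∪ J)ᶜ := by rw [disjoint_left]; grind [mem_compl]
  have d3 : Disjoint (I ∩ J) (J \ I) := by rw [disjoint_left]; grind [mem_compl]
  have d4 : Disjoint (I \ J) (I ∪ J)ᶜ := by rw [disjoint_left]; grind [mem_compl]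
  have d5 : Disjoint (I \ J) (J \ I) := by rw [disjoint_left]; grind [mem_compl]
  let g : ι → ι → ℂ := fun r s => (k * t r - k⁻¹ * t s) / (t r - t s)
  let g' : ι → ι → ℂ := fun r s =>
    (k * shift p I t r - k⁻¹ * shift p I t s) / (shift p I t r - shift p I t s)
  have hA : ruijCoeff k t I = (∏ r ∈ I ∩ J, ∏ s ∈ J \ I, g r s) *
      (∏ r ∈ I ∩ J, ∏ s ∈ (I ∪ J)ᶜ, g r s) * ((∏ r ∈ I \ J, ∏ s ∈ J \ I, g r s) *
      ∏ r ∈ I \ J, ∏ s ∈ (I ∪ J)ᶜ, g r s) := by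
    rw [← prod_mul_distrib, ← prod_mul_distrib]
    simp only [← prod_union d2, ← hI']
    rw [← prod_union d1, ← hI]
    rfl
  have hB : ruijCoeff k (shift p I t) J = (∏ r ∈ I ∩ J, ∏ s ∈ I \ J, g' r s) *
      (∏ r ∈ I ∩ J, ∏ s ∈ (I ∪ J)ᶜ, g' r s) * ((∏ r ∈ J \ I, ∏ s ∈ I \ J, g' r s) *
      ∏ r ∈ J \ I, ∏ s ∈ (I ∪ J)ᶜ, g' r s) := by
    rw [← prod_mul_distrib, ← prod_mul_distrib]
    simp only [← prod_union d4, ← hJ']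
    rw [← prod_union d3, ← hJ]
    rfl
  have e1 : ∏ r ∈ I ∩ J, ∏ s ∈ I \ J, g' r s = ∏ r ∈ I ∩ J, ∏ s ∈ I \ J, g r s := by
    refine prod_congr rfl fun r hr => prod_congr rfl fun s hs => ?_
    simp only [g', g, shift, (mem_inter.mp hr).1, (mem_sdiff.mp hs).1, if_true]
    rw [mul_left_comm k, mul_left_comm k⁻¹, ← mul_sub, ← mul_sub, mul_div_mul_left _ _ hp]
  have e2 : ∏ r ∈ I ∩ J, ∏ s ∈ (I ∪ J)ᶜ, g' r s = ∏ r ∈ I ∩ J, ∏ s ∈ (I ∪ J)ᶜ,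
      ((k * (p * t r) - k⁻¹ * t s) / (p * t r - t s)) := by
    refine prod_congr rfl fun r hr => prod_congr rfl fun s hs => ?_
    have hs' : s ∉ I := by grind [mem_compl]
    simp only [g', shift, (mem_inter.mp hr).1, hs', if_true, if_false]
  have e3 : ∏ r ∈ J \ I, ∏ s ∈ I \ J, g' r s = ∏ r ∈ I \ J, ∏ s ∈ J \ I,
      ((k * t s - k⁻¹ * (p * t r)) / (t s - p * t r)) := by
    rw [prod_comm]
    refine prod_congr rfl fun r hr => prod_congr rfl fun s hs => ?_
    simp only [g', shift, (mem_sdiff.mp hr).1, (mem_sdiff.mp hs).2, if_true, if_false]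
  have e4 : ∏ r ∈ J \ I, ∏ s ∈ (I ∪ J)ᶜ, g' r s = ∏ r ∈ J \ I, ∏ s ∈ (I ∪ J)ᶜ, g r s := by
    refine prod_congr rfl fun r hr => prod_congr rfl fun s hs => ?_
    have hs' : s ∉ I := by grind [mem_compl]
    simp only [g', g, shift, (mem_sdiff.mp hr).2, hs', if_false]
  have e5 : ∏ r ∈ I \ J, ∏ s ∈ J \ I, coupling k p (t r) (t s) =
      (∏ r ∈ I \ J, ∏ s ∈ J \ I, g r s) * ∏ r ∈ I \ J, ∏ s ∈ J \ I,
      ((k * t s - k⁻¹ * (p * t r)) / (t s - p * t r)) := by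
    rw [← prod_mul_distrib]
    simp only [← prod_mul_distrib]
    refine prod_congr rfl fun r hr => prod_congr rfl fun s hs => ?_
    rw [coupling, div_mul_div_comm]
  rw [hA, hB, e1, e2, e3, e4, e5, ruijPairCoeff, hM, prod_union d5]
  simp only [prod_union d5, prod_mul_distrib]
  ring

omit [Fintype ι] in
theorem shift_shift (p : ℂ) (t : ι → ℂ) (I J : Finset ι) :
    shift p J (shift p I t) = shift p (I ∩ J) (shift p (I ∪ J) t) := by
  ext r
  simp only [shift, mem_inter, mem_union]
  by_cases h1 : r ∈ I <;> by_cases h2 : r ∈ J <;> simp [h1, h2]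

theorem ruij_comm {k p : ℂ} (hk : k ≠ 0) (hp : p ≠ 0) (hp1 : p ≠ 1) (hp2 : p ^ 2 ≠ 1)
    (t : ι → ℂ) (ht : GenericOn p t univ) (i j : ℕ) (F : (ι → ℂ) → ℂ) :
    ruij k p i (ruij k p j F) t = ruij k p j (ruij k p i F) t := by
  let D : Finset ι × Finset ι → ℂ := fun x =>
    ruijPairCoeff k p t x.1 x.2 * F (shift p x.1 (shift p x.2 t))
  have key : ∀ φ : ι → ι → ℂ,
      ∑ x ∈ powersetCard i univ ×ˢ powersetCard j univ, D (x.1 ∩ x.2, x.1 ∪ x.2) *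
        ∏ r ∈ x.1 \ x.2, ∏ s ∈ x.2 \ x.1, φ r s =
      ∑ y : Finset ι × Finset ι, if y.1 ⊆ y.2 then D y * pairSum φ
        (fun n => if #y.1 + n = i ∧ #y.1 + (#(y.2 \ y.1) - n) = j then 1 else 0) (y.2 \ y.1)
        else 0 := by
    intro φ
    rw [← sum_fiberwise (powersetCard i univ ×ˢ powersetCard j univ)
      (fun x => ((x.1 ∩ x.2, x.1 ∪ x.2) : Finset ι × Finset ι))]
    refine sum_congr rfl fun y _ => ?_
    split_ifs with hy
    · rw [← sum_fiber_inter_union φ i j ({x ∈ powersetCard i univ ×ˢ powersetCard j univ |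
        (x.1 ∩ x.2, x.1 ∪ x.2) = y}) hy, mul_sum]
      · refine sum_congr rfl fun x hx => ?_
        rw [(mem_filter.mp hx).2]
      · intro I J
        simp [Prod.ext_iff]
    · refine sum_eq_zero fun x hx => absurd ?_ hy
      rw [← (mem_filter.mp hx).2]
      exact inter_subset_left.trans subset_union_left
  have h1 : ruij k p i (ruij k p j F) t = ∑ x ∈ powersetCard i univ ×ˢ powersetCard j univ,
      D (x.1 ∩ x.2, x.1 ∪ x.2) * ∏ r ∈ x.1 \ x.2, ∏ s ∈ x.2 \ x.1, coupling k p (t r) (t s) := by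
    rw [sum_product]
    simp only [ruij, mul_sum]
    refine sum_congr rfl fun I _ => sum_congr rfl fun J _ => ?_
    rw [← mul_assoc, ruijCoeff_mul_ruijCoeff_shift hp, shift_shift]
    ring
  have h2 : ruij k p j (ruij k p i F) t = ∑ x ∈ powersetCard i univ ×ˢ powersetCard j univ,
      D (x.1 ∩ x.2, x.1 ∪ x.2) * ∏ r ∈ x.1 \ x.2, ∏ s ∈ x.2 \ x.1, coupling k p (t s) (t r) := by
    rw [sum_product_right]
    simp only [ruij, mul_sum]
    refine sum_congr rfl fun J _ => sum_congr rfl fun I _ => ?_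
    rw [← mul_assoc, ruijCoeff_mul_ruijCoeff_shift hp, shift_shift, inter_comm J, union_comm J,
      prod_comm]
    ring
  rw [h1, h2, key, key]
  refine sum_congr rfl fun y _ => ?_
  rw [pairSum_coupling_comm hk hp hp1 hp2 t (y.2 \ y.1)
    (ht.mono (subset_univ _))]

end Operators

section Antisymmetric
open MvPolynomial

variable {N : ℕ}

/-- Substituting `X_b` for `X_a`. -/
noncomputable def identify (a b : Fin N) : MvPolynomial (Fin N) ℂ →ₐ[ℂ] MvPolynomial (Fin N) ℂ :=
  rename (Function.update id a b)

theorem X_sub_X_dvd_sub_identify (a b : Fin N) (f : MvPolynomial (Fin N) ℂ) :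
    X a - X b ∣ f - identify a b f := by
  rw [← Ideal.mem_span_singleton, ← Ideal.Quotient.eq]
  have h : Ideal.Quotient.mkₐ ℂ (Ideal.span {(X a - X b : MvPolynomial (Fin N) ℂ)}) =
      (Ideal.Quotient.mkₐ ℂ _).comp (identify a b) := by
    refine algHom_ext fun i => ?_
    simp only [AlgHom.comp_apply, identify, rename_X]
    by_cases hi : i = a
    · subst hi
      rw [Function.update_self]
      exact Ideal.Quotient.eq.mpr (Ideal.mem_span_singleton_self _)
    · rw [Function.update_of_ne hi, id]
  exact DFunLike.congr_fun h f

theorem X_sub_X_dvd_iff {a b : Fin N} {f : MvPolynomial (Fin N) ℂ} :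
    X a - X b ∣ f ↔ identify a b f = 0 := by
  refine ⟨?_, fun h => ?_⟩
  · rintro ⟨g, rfl⟩
    by_cases hab : b = a
    · simp [identify, hab]
    · simp [identify, Function.update_of_ne hab]
  · simpa [h] using X_sub_X_dvd_sub_identify a b f

theorem X_sub_X_ne_zero {a b : Fin N} (h : a ≠ b) : (X a - X b : MvPolynomial (Fin N) ℂ) ≠ 0 :=
  sub_ne_zero.mpr fun h' => h (X_injective h')

theorem prime_X_sub_X {a b : Fin N} (h : a ≠ b) :
    Prime (X a - X b : MvPolynomial (Fin N) ℂ) := by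
  refine ⟨X_sub_X_ne_zero h, fun hu => ?_, fun f g hfg => ?_⟩
  · have h1 := hu.map (aeval (R := ℂ) (fun _ => (0 : ℂ)))
    simp at h1
  · rw [X_sub_X_dvd_iff, map_mul, mul_eq_zero] at hfg
    rwa [X_sub_X_dvd_iff, X_sub_X_dvd_iff]

theorem not_X_sub_X_dvd {a b c d : Fin N} (hab : a < b) (hcd : c < d) (h : (a, b) ≠ (c, d)) :
    ¬ (X b - X a : MvPolynomial (Fin N) ℂ) ∣ X d - X c := by
  rw [X_sub_X_dvd_iff, identify, map_sub, rename_X, rename_X]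
  refine X_sub_X_ne_zero fun h' => ?_
  simp only [Function.update_apply, id] at h'
  grind

variable (N) in
/-- The Vandermonde polynomial. -/
noncomputable def vdm : MvPolynomial (Fin N) ℂ := ∏ i, ∏ j ∈ Ioi i, (X j - X i)

theorem eval_vdm (t : Fin N → ℂ) : eval t (vdm N) = (Matrix.vandermonde t).det := by
  simp [vdm, Matrix.det_vandermonde]

theorem eval_vdm_comp (t : Fin N → ℂ) (w : Equiv.Perm (Fin N)) :
    eval (t ∘ w) (vdm N) = Equiv.Perm.sign w * eval t (vdm N) := by
  rw [eval_vdm, eval_vdm, ← Matrix.det_permute]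
  rfl

theorem eval_vdm_ne_zero {t : Fin N → ℂ} (ht : Function.Injective t) :
    eval t (vdm N) ≠ 0 := by
  rw [eval_vdm]
  exact Matrix.det_vandermonde_ne_zero_iff.mpr ht

theorem vdm_dvd {f : MvPolynomial (Fin N) ℂ}
    (hf : ∀ t : Fin N → ℂ, ¬ Function.Injective t → eval t f = 0) : vdm N ∣ f := by
  rw [vdm, prod_sigma']
  refine prod_dvd_of_isRelPrime (fun x hx y hy hxy => ?_) fun x hx => ?_
  · have hx' : x.1 < x.2 := mem_Ioi.mp (mem_sigma.mp hx).2
    have hy' : y.1 < y.2 := mem_Ioi.mp (mem_sigma.mp hy).2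
    refine (prime_X_sub_X hx'.ne').irreducible.isRelPrime_iff_not_dvd.mpr
      (not_X_sub_X_dvd hx' hy' fun h => hxy ?_)
    rw [Prod.ext_iff] at h
    exact Sigma.ext h.1 (heq_of_eq h.2)
  · have hx' : x.1 < x.2 := mem_Ioi.mp (mem_sigma.mp hx).2
    rw [X_sub_X_dvd_iff]
    refine MvPolynomial.funext fun t => ?_
    rw [identify, eval_rename, map_zero]
    refine hf _ fun hinj => hx'.ne (hinj ?_)
    simp [hx'.ne]

theorem eq_of_eval_eq_of_generic (p : ℂ) {f g : MvPolynomial (Fin N) ℂ}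
    (h : ∀ t, GenericOn p t univ → eval t f = eval t g) : f = g := by
  let Ψ : MvPolynomial (Fin N) ℂ := (∏ r, X r) * ∏ r, ∏ s ∈ {r}ᶜ,
    ((X r - X s) * (X r - C p * X s) * (X r - C (p ^ 2) * X s))
  have hlin : ∀ r s : Fin N, r ≠ s → ∀ a : ℂ,
      (X r - C a * X s : MvPolynomial (Fin N) ℂ) ≠ 0 := by
    intro r s hrs a h
    have := congrArg (eval (Pi.single r 1)) h
    simp [hrs.symm] at this
  have hΨ : Ψ ≠ 0 := by
    refine mul_ne_zero (prod_ne_zero_iff.mpr fun r _ => X_ne_zero r)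
      (prod_ne_zero_iff.mpr fun r _ => prod_ne_zero_iff.mpr fun s hs => ?_)
    have hrs : r ≠ s := by simpa [eq_comm] using hs
    exact mul_ne_zero (mul_ne_zero (X_sub_X_ne_zero hrs) (hlin r s hrs p)) (hlin r s hrs _)
  refine sub_eq_zero.mp ((mul_eq_zero.mp (?_ : Ψ * (f - g) = 0)).resolve_left hΨ)
  refine MvPolynomial.funext fun t => ?_
  rw [map_mul, map_zero, mul_eq_zero]
  by_cases hΨt : eval t Ψ = 0
  · exact Or.inl hΨt
  · right
    simp only [Ψ, map_mul, eval_prod, eval_X, eval_C, map_sub, mul_eq_zero, not_or,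
      prod_eq_zero_iff, not_exists, not_and, mem_univ, true_imp_iff, mem_compl, mem_singleton,
      sub_eq_zero] at hΨt
    rw [map_sub, sub_eq_zero]
    refine h t ⟨fun r _ => hΨt.1 r, fun r _ s _ hrs => ?_⟩
    obtain ⟨⟨h1, h2⟩, h3⟩ := hΨt.2 r s hrs.symm
    exact ⟨h1, h2, h3⟩

theorem GenericOn.injective {ι : Type*} [Fintype ι] {p : ℂ} {t : ι → ℂ}
    (h : GenericOn p t univ) : Function.Injective t := fun r s hrs => by
  by_contra hne
  exact (h.2 r (mem_univ r) s (mem_univ s) hne).1 hrs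

theorem eq_of_eval_eq_of_injective {f g : MvPolynomial (Fin N) ℂ}
    (h : ∀ t, Function.Injective t → eval t f = eval t g) : f = g :=
  eq_of_eval_eq_of_generic 0 fun t ht => h t ht.injective

theorem vdm_dvd_of_antisymmetric {f : MvPolynomial (Fin N) ℂ}
    (hf : ∀ t : Fin N → ℂ, Function.Injective t → ∀ a b, a ≠ b →
      eval (t ∘ Equiv.swap a b) f = - eval t f) : vdm N ∣ f := by
  refine vdm_dvd fun t ht => ?_
  obtain ⟨a, b, hab, hne⟩ := Function.not_injective_iff.mp ht
  have h : rename (Equiv.swap a b) f = -f := eq_of_eval_eq_of_injective fun t ht => by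
    rw [eval_rename, hf t ht a b hne, map_neg]
  have h' := congrArg (eval t) h
  have ht' : t ∘ Equiv.swap a b = t := by
    ext r
    rw [Function.comp_apply, Equiv.swap_apply_def]
    split_ifs <;> simp_all
  rw [eval_rename, ht', map_neg] at h'
  exact self_eq_neg.mp h'

end Antisymmetric

section Shift
open MvPolynomial

variable {N : ℕ}

/-- `shift` on polynomials. -/
noncomputable def shiftPoly (p : ℂ) (I : Finset (Fin N)) :
    MvPolynomial (Fin N) ℂ →ₐ[ℂ] MvPolynomial (Fin N) ℂ :=
  aeval fun r => if r ∈ I then C p * X r else X r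

theorem eval_shiftPoly (p : ℂ) (I : Finset (Fin N)) (f : MvPolynomial (Fin N) ℂ)
    (t : Fin N → ℂ) : eval t (shiftPoly p I f) = eval (shift p I t) f := by
  have h : ((aeval t).comp (shiftPoly p I) : MvPolynomial (Fin N) ℂ →ₐ[ℂ] ℂ) =
      aeval (shift p I t) := by
    refine algHom_ext fun r => ?_
    simp only [AlgHom.comp_apply, shiftPoly, aeval_X, shift]
    split_ifs <;> simp
  simpa [aeval_eq_eval] using DFunLike.congr_fun h f

theorem coeff_shiftPoly (p : ℂ) (I : Finset (Fin N)) (f : MvPolynomial (Fin N) ℂ)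
    (ν : Fin N →₀ ℕ) : coeff ν (shiftPoly p I f) = (∏ r ∈ I, p ^ ν r) * coeff ν f := by
  induction f using MvPolynomial.induction_on' with
  | monomial u a =>
    have h : shiftPoly p I (monomial u a) = monomial u ((∏ r ∈ I, p ^ u r) * a) := by
      refine MvPolynomial.funext fun t => ?_
      rw [eval_shiftPoly, eval_monomial, eval_monomial, Finsupp.prod_fintype _ _ (by simp),
        Finsupp.prod_fintype _ _ (by simp), mul_comm _ a, mul_assoc, ← Fintype.prod_ite_mem I,
        ← prod_mul_distrib]
      refine congrArg _ (prod_congr rfl fun r _ => ?_)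
      simp only [shift]
      split_ifs
      · rw [mul_pow]
      · rw [one_mul]
    rw [h, coeff_monomial, coeff_monomial]
    split_ifs with hu
    · rw [hu]
    · simp
  | add f g hf hg => rw [map_add, coeff_add, hf, hg, coeff_add, mul_add]

end Shift

section Numerator
open MvPolynomial

variable {N : ℕ}

/-- The power of `k` attached to the ordered pair `(i, j)`. -/
noncomputable def pairWeight (k : ℂ) (I : Finset (Fin N)) (i j : Fin N) : ℂ :=
  (if i ∈ I then k else 1) * (if j ∈ I then k⁻¹ else 1)

/-- The polynomial `ruijCoeff k · I` times the Vandermonde polynomial. -/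
noncomputable def ruijNumer (k : ℂ) (I : Finset (Fin N)) : MvPolynomial (Fin N) ℂ :=
  ∏ i, ∏ j ∈ Ioi i, (C (pairWeight k I j i) * X j - C (pairWeight k I i j) * X i)

theorem eval_ruijNumer {k : ℂ} (hk : k ≠ 0) (I : Finset (Fin N)) {t : Fin N → ℂ}
    (ht : Function.Injective t) :
    eval t (ruijNumer k I) = ruijCoeff k t I * eval t (vdm N) := by
  let f : Fin N → Fin N → ℂ := fun s r =>
    if r ∈ I then if s ∈ I then 1 else (k * t r - k⁻¹ * t s) / (t r - t s) else 1
  have h1 : ruijCoeff k t I = ∏ i, ∏ j ∈ Ioi i, f j i * f i j := by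
    rw [prod_prod_Ioi_mul_eq_prod_prod_off_diag f, ruijCoeff, ← prod_subset (subset_univ I)]
    · refine prod_congr rfl fun r hr => ?_
      have hsub : Iᶜ ⊆ {r}ᶜ := compl_subset_compl.mpr (singleton_subset_iff.mpr hr)
      rw [← prod_subset hsub]
      · refine prod_congr rfl fun s hs => ?_
        simp only [f, hr, mem_compl.mp hs, if_true, if_false]
      · intro s _ hs
        simp only [mem_compl, not_not] at hs
        simp only [f, hr, hs, if_true]
    · intro r _ hr
      simp only [f, hr, if_false, prod_const_one]
  rw [h1, ruijNumer, vdm]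
  simp only [map_prod, ← prod_mul_distrib]
  refine prod_congr rfl fun i _ => prod_congr rfl fun j hj => ?_
  have hne : t j - t i ≠ 0 := sub_ne_zero.mpr fun h => (mem_Ioi.mp hj).ne' (ht h)
  have hne' : t i - t j ≠ 0 := sub_ne_zero.mpr fun h => (mem_Ioi.mp hj).ne (ht h)
  simp only [map_sub, map_mul, eval_C, eval_X, pairWeight, f]
  split_ifs
  · simp [hk]
  · field_simp
  · field_simp
    ring
  · simp

theorem prod_pairWeight {k : ℂ} (hk : k ≠ 0) (I : Finset (Fin N)) :
    ∏ i, ∏ j ∈ Ioi i, pairWeight k I i j = ∏ r ∈ I, k ^ deltaVec N r := by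
  simp only [pairWeight, prod_mul_distrib]
  rw [prod_comm' (f := fun _ j => if j ∈ I then k⁻¹ else 1) (s := univ)
    (t := fun i => Ioi i) (t' := univ) (s' := fun j => Iio j)
    (by simp), ← prod_mul_distrib]
  simp only [prod_const, Fin.card_Ioi, Fin.card_Iio]
  rw [← prod_subset (subset_univ I) (by intro r _ hr; simp [hr])]
  refine prod_congr rfl fun r hr => ?_
  rw [if_pos hr, if_pos hr, inv_pow, ← zpow_natCast, ← zpow_natCast, ← zpow_neg, ← zpow_add₀ hk]
  congr 1
  have := r.2
  rw [deltaVec]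
  omega

theorem MonomialOrder.degree_prod_le_and_coeff {σ R α : Type*} [CommRing R] (m : MonomialOrder σ)
    (s : Finset α) (f : α → MvPolynomial σ R) (d : α → σ →₀ ℕ)
    (h : ∀ x ∈ s, m.toSyn (m.degree (f x)) ≤ m.toSyn (d x)) :
    m.toSyn (m.degree (∏ x ∈ s, f x)) ≤ m.toSyn (∑ x ∈ s, d x) ∧
      coeff (∑ x ∈ s, d x) (∏ x ∈ s, f x) = ∏ x ∈ s, coeff (d x) (f x) := by
  classical
  induction s using Finset.induction_on with
  | empty => simp
  | insert a s ha ih =>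
    obtain ⟨ih1, ih2⟩ := ih fun x hx => h x (mem_insert_of_mem hx)
    have h1 := h a (mem_insert_self a s)
    rw [prod_insert ha, sum_insert ha, prod_insert ha,
      m.coeff_mul_of_add_of_degree_le h1 ih1, ih2]
    refine ⟨m.degree_mul_le.trans ?_, rfl⟩
    rw [map_add, map_add]
    exact add_le_add h1 ih1

open MonomialOrder in
theorem degree_linear_le {i j : Fin N} (hij : i < j) (a b : ℂ) :
    degLex.toSyn (degLex.degree (C a * X j - C b * X i : MvPolynomial (Fin N) ℂ)) ≤
      degLex.toSyn (Finsupp.single i 1) := by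
  rw [degLex.degree_le_iff]
  intro c hc
  rw [mem_support_iff, coeff_sub, coeff_C_mul, coeff_C_mul, coeff_X, coeff_X] at hc
  by_cases h1 : Finsupp.single i 1 = c
  · rw [h1]
  · by_cases h2 : Finsupp.single j 1 = c
    · rw [← h2]
      exact degLex_single_le_iff.mpr hij.le
    · simp [h1, h2] at hc

theorem coeff_linear {i j : Fin N} (hij : i < j) (a b : ℂ) :
    coeff (Finsupp.single i 1) (C a * X j - C b * X i : MvPolynomial (Fin N) ℂ) = -b := by
  have h : Finsupp.single j 1 ≠ Finsupp.single i 1 := fun h =>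
    hij.ne' (Finsupp.single_left_injective one_ne_zero h)
  simp [coeff_X, h]

variable (N) in
/-- The leading exponent of the Vandermonde polynomial. -/
noncomputable def vdmExp : Fin N →₀ ℕ := ∑ i : Fin N, ∑ _j ∈ Ioi i, Finsupp.single i 1

open MonomialOrder in
theorem degree_ruijNumer_le_and_coeff {k : ℂ} (hk : k ≠ 0) (I : Finset (Fin N)) :
    degLex.toSyn (degLex.degree (ruijNumer k I)) ≤ degLex.toSyn (vdmExp N) ∧
      coeff (vdmExp N) (ruijNumer k I) =
        (∏ i : Fin N, ∏ _j ∈ Ioi i, (-1)) * ∏ r ∈ I, k ^ deltaVec N r := by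
  have h := MonomialOrder.degree_prod_le_and_coeff degLex
    ((univ : Finset (Fin N)).sigma fun i => Ioi i)
    (fun x => (C (pairWeight k I x.2 x.1) * X x.2 - C (pairWeight k I x.1 x.2) * X x.1 :
      MvPolynomial (Fin N) ℂ)) (fun x => Finsupp.single x.1 1)
    (fun x hx => degree_linear_le (mem_Ioi.mp (mem_sigma.mp hx).2) _ _)
  rw [prod_sigma, prod_sigma, sum_sigma] at h
  refine ⟨h.1, h.2.trans ?_⟩
  rw [← prod_pairWeight hk, ← prod_mul_distrib]
  refine prod_congr rfl fun i _ => ?_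
  rw [← prod_mul_distrib]
  refine prod_congr rfl fun j hj => ?_
  rw [coeff_linear (mem_Ioi.mp hj), neg_one_mul]

theorem ruijNumer_empty (k : ℂ) : ruijNumer k (∅ : Finset (Fin N)) = vdm N := by
  simp [ruijNumer, vdm, pairWeight]

end Numerator

section Symmetry

variable {ι : Type*} [Fintype ι] [DecidableEq ι]

theorem ruij_comp_perm (k p : ℂ) (i : ℕ) {F : (ι → ℂ) → ℂ}
    (hF : ∀ (w : Equiv.Perm ι) t, F (t ∘ w) = F t) (w : Equiv.Perm ι) (t : ι → ℂ) :
    ruij k p i F (t ∘ w) = ruij k p i F t := by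
  unfold ruij
  refine sum_equiv w.finsetCongr (by simp [mem_powersetCard]) fun I _ => ?_
  rw [Equiv.finsetCongr_apply]
  congr 1
  · rw [ruijCoeff, ruijCoeff, prod_map]
    refine prod_congr rfl fun r _ => ?_
    exact prod_equiv w (by simp) fun s _ => rfl
  · rw [← hF w (shift p (I.map w.toEmbedding) t)]
    congr 1
    ext r
    simp [shift]

end Symmetry

section PolynomialOperator
open MvPolynomial MonomialOrder

variable {N : ℕ}

theorem eval_comp_of_isSymmetric {f : MvPolynomial (Fin N) ℂ} (hf : f.IsSymmetric)
    (w : Equiv.Perm (Fin N)) (t : Fin N → ℂ) : eval (t ∘ w) f = eval t f := by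
  rw [← eval_rename, hf w]

/-- The Ruijsenaars operators preserve symmetric polynomials and are triangular. -/
theorem exists_ruij_polynomial {k : ℂ} (hk : k ≠ 0) (p : ℂ) (i : ℕ)
    {f : MvPolynomial (Fin N) ℂ} (hf : f.IsSymmetric) :
    ∃ g : MvPolynomial (Fin N) ℂ, g.IsSymmetric ∧
      (∀ t, Function.Injective t → eval t g = ruij k p i (fun t => eval t f) t) ∧
      ∀ μ, degLex.toSyn (degLex.degree f) ≤ degLex.toSyn μ →
        degLex.toSyn (degLex.degree g) ≤ degLex.toSyn μ ∧
        coeff μ g = (∑ I ∈ powersetCard i univ, ∏ r ∈ I, (p ^ μ r * k ^ deltaVec N r)) *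
          coeff μ f := by
  let P : MvPolynomial (Fin N) ℂ :=
    ∑ I ∈ powersetCard i univ, ruijNumer k I * shiftPoly p I f
  have hsymm := ruij_comp_perm k p i (F := fun t => eval t f) (eval_comp_of_isSymmetric hf)
  have hP : ∀ t, Function.Injective t →
      eval t P = eval t (vdm N) * ruij k p i (fun t => eval t f) t := by
    intro t ht
    simp only [P, map_sum, map_mul, ruij, mul_sum]
    refine sum_congr rfl fun I _ => ?_
    rw [eval_ruijNumer hk I ht, eval_shiftPoly]
    ring
  obtain ⟨g, hg⟩ : vdm N ∣ P := by
    refine vdm_dvd_of_antisymmetric fun t ht a b hab => ?_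
    rw [hP t ht, hP _ (ht.comp (Equiv.injective _)), hsymm, eval_vdm_comp, Equiv.Perm.sign_swap hab]
    simp
  have hgt : ∀ t, Function.Injective t → eval t g = ruij k p i (fun t => eval t f) t := by
    intro t ht
    have h := hP t ht
    rw [hg, map_mul] at h
    exact mul_left_cancel₀ (eval_vdm_ne_zero ht) h
  refine ⟨g, fun w => eq_of_eval_eq_of_injective fun t ht => ?_, hgt, fun μ hμ => ?_⟩
  · rw [eval_rename, hgt _ (ht.comp w.injective), hsymm, hgt t ht]
  have hs : (∏ i : Fin N, ∏ _j ∈ Ioi i, (-1 : ℂ)) ≠ 0 :=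
    prod_ne_zero_iff.mpr fun _ _ => prod_ne_zero_iff.mpr fun _ _ => by simp
  have hv := degree_ruijNumer_le_and_coeff hk (∅ : Finset (Fin N))
  rw [ruijNumer_empty, prod_empty, mul_one] at hv
  have hshift : ∀ I : Finset (Fin N),
      degLex.toSyn (degLex.degree (shiftPoly p I f)) ≤ degLex.toSyn μ := by
    intro I
    refine degLex.degree_le_iff.mpr fun c hc => degLex.degree_le_iff.mp hμ c ?_
    rw [mem_support_iff, coeff_shiftPoly] at hc
    exact mem_support_iff.mpr (right_ne_zero_of_mul hc)
  have hvd : degLex.degree (vdm N) = vdmExp N := by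
    refine degLex.toSyn.injective (le_antisymm hv.1 (degLex.le_degree ?_))
    rw [mem_support_iff, hv.2]
    exact hs
  have hgdeg : degLex.toSyn (degLex.degree g) ≤ degLex.toSyn μ := by
    by_cases hg0 : g = 0
    · rw [hg0, degLex.degree_zero]
      simp
    have hv0 : vdm N ≠ 0 := fun h => hs (by rw [← hv.2, h, coeff_zero])
    have h1 : degLex.toSyn (degLex.degree P) ≤ degLex.toSyn (vdmExp N + μ) := by
      refine degLex.degree_sum_le.trans (Finset.sup_le fun I _ => degLex.degree_mul_le.trans ?_)
      rw [map_add, map_add]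
      exact add_le_add (degree_ruijNumer_le_and_coeff hk I).1 (hshift I)
    rw [hg, degLex.degree_mul hv0 hg0, hvd, map_add, map_add] at h1
    exact le_of_add_le_add_left h1
  refine ⟨hgdeg, ?_⟩
  have h1 : coeff (vdmExp N + μ) (vdm N * g) = coeff (vdmExp N + μ) P := by rw [hg]
  rw [degLex.coeff_mul_of_add_of_degree_le hv.1 hgdeg, hv.2, coeff_sum] at h1
  refine mul_left_cancel₀ hs (h1.trans ?_)
  rw [sum_mul, mul_sum]
  refine sum_congr rfl fun I _ => ?_
  obtain ⟨h2, h3⟩ := degree_ruijNumer_le_and_coeff hk I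
  rw [degLex.coeff_mul_of_add_of_degree_le h2 (hshift I), h3, coeff_shiftPoly, prod_mul_distrib]
  ring

theorem ruij_congr {k p : ℂ} (hp : p ≠ 0) (i : ℕ) {F G : (Fin N → ℂ) → ℂ}
    (h : ∀ t, Function.Injective t → F t = G t) {t : Fin N → ℂ} (ht : GenericOn p t univ) :
    ruij k p i F t = ruij k p i G t := by
  refine sum_congr rfl fun I _ => ?_
  rw [h _ fun r s hrs => ?_]
  by_contra hne
  have h1 := ht.2 r (mem_univ r) s (mem_univ s) hne
  have h2 := ht.2 s (mem_univ s) r (mem_univ r) (Ne.symm hne)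
  simp only [shift] at hrs
  split_ifs at hrs
  · exact h1.1 (mul_left_cancel₀ hp hrs)
  · exact h2.2.1 hrs.symm
  · exact h1.2.1 hrs
  · exact h1.1 hrs

/-- The symmetric polynomials all of whose exponents are at most `μ`. -/
noncomputable def symmetricLE (μ : Fin N →₀ ℕ) : Submodule ℂ (MvPolynomial (Fin N) ℂ) where
  carrier := {f | f.IsSymmetric ∧ ∀ ν, degLex.toSyn μ < degLex.toSyn ν → coeff ν f = 0}
  zero_mem' := ⟨IsSymmetric.zero, fun _ _ => coeff_zero _⟩
  add_mem' hf hg := ⟨hf.1.add hg.1, fun ν hν => by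
    rw [coeff_add, hf.2 ν hν, hg.2 ν hν, add_zero]⟩
  smul_mem' a f hf := ⟨hf.1.smul a, fun ν hν => by
    rw [coeff_smul, hf.2 ν hν, smul_zero]⟩

theorem mem_symmetricLE {μ : Fin N →₀ ℕ} {f : MvPolynomial (Fin N) ℂ} :
    f ∈ symmetricLE μ ↔ f.IsSymmetric ∧ degLex.toSyn (degLex.degree f) ≤ degLex.toSyn μ := by
  refine and_congr_right fun _ => ?_
  rw [degLex.degree_le_iff]
  refine forall_congr' fun ν => ?_
  rw [mem_support_iff, ← not_lt, not_imp_not]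

instance (μ : Fin N →₀ ℕ) : FiniteDimensional ℂ (symmetricLE μ) := by
  have h : symmetricLE μ ≤ restrictTotalDegree (Fin N) ℂ μ.degree := fun f hf => by
    rw [mem_restrictTotalDegree, ← degree_degLexDegree]
    have h := (mem_symmetricLE.mp hf).2
    exact Finsupp.DegLex.monotone_degree (degLex_le_iff.mp h)
  exact Submodule.finiteDimensional_of_le h

/-- The Ruijsenaars operator on symmetric polynomials of bounded degree. -/
theorem exists_ruij_linearMap {k : ℂ} (hk : k ≠ 0) (p : ℂ) (i : ℕ) (μ : Fin N →₀ ℕ) :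
    ∃ L : Module.End ℂ (symmetricLE μ),
      (∀ f t, Function.Injective t → eval t (L f : MvPolynomial (Fin N) ℂ) =
        ruij k p i (fun t => eval t (f : MvPolynomial (Fin N) ℂ)) t) ∧
      ∀ f, coeff μ (L f : MvPolynomial (Fin N) ℂ) =
        (∑ I ∈ powersetCard i univ, ∏ r ∈ I, (p ^ μ r * k ^ deltaVec N r)) *
          coeff μ (f : MvPolynomial (Fin N) ℂ) := by
  choose g hg1 hg2 hg3 using fun f : symmetricLE μ =>
    exists_ruij_polynomial hk p i (mem_symmetricLE.mp f.2).1
  have hg4 := fun f : symmetricLE μ => hg3 f μ (mem_symmetricLE.mp f.2).2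
  refine ⟨⟨⟨fun f => ⟨g f, mem_symmetricLE.mpr ⟨hg1 f, (hg4 f).1⟩⟩, ?_⟩, ?_⟩, hg2,
    fun f => (hg4 f).2⟩
  · intro f f'
    refine Subtype.ext (eq_of_eval_eq_of_injective fun t ht => ?_)
    simp only [Submodule.coe_add, map_add, hg2 _ t ht, ruij, mul_add, sum_add_distrib]
  · intro a f
    refine Subtype.ext (eq_of_eval_eq_of_injective fun t ht => ?_)
    simp only [Submodule.coe_smul, smul_eval, hg2 _ t ht, ruij, mul_sum, RingHom.id_apply]
    exact sum_congr rfl fun I _ => by ring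

theorem toDegLex_mapDomain_le (μ : Fin N →₀ ℕ) (hμ : Antitone μ) (w : Equiv.Perm (Fin N)) :
    degLex.toSyn (Finsupp.mapDomain w μ) ≤ degLex.toSyn μ := by
  rw [degLex_le_iff, Finsupp.DegLex.le_iff]
  refine Or.inr ⟨?_, ?_⟩
  · simp only [ofDegLex_toDegLex, Finsupp.degree_eq_sum, Finsupp.mapDomain_equiv_apply]
    exact Equiv.sum_comp w.symm μ
  · rw [← not_lt]
    rintro ⟨j, hj1, hj2⟩
    simp only [ofDegLex_toDegLex, ofLex_toLex, Finsupp.mapDomain_equiv_apply] at hj1 hj2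
    have hcard : #{r | μ (w.symm j) ≤ μ (w.symm r)} = #{r | μ (w.symm j) ≤ μ r} :=
      card_equiv w.symm (by simp)
    refine absurd hcard (card_lt_card (ssubset_iff.mpr ⟨j, ?_, fun r hr => ?_⟩)).ne'
    · simpa using hj2
    · rcases mem_insert.mp hr with rfl | hr
      · simp
      · simp only [mem_filter, mem_univ, true_and] at hr ⊢
        rw [← hj1 r (lt_of_not_ge fun h => absurd (hr.trans (hμ h)) (not_le.mpr hj2))]
        exact hr

/-- A symmetric polynomial with leading exponent `μ`, the orbit sum of a monomial. -/
theorem exists_coeff_ne_zero (μ : Fin N →₀ ℕ) (hμ : Antitone μ) :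
    ∃ f : symmetricLE μ, coeff μ (f : MvPolynomial (Fin N) ℂ) ≠ 0 := by
  let f : MvPolynomial (Fin N) ℂ := ∑ w : Equiv.Perm (Fin N), rename w (monomial μ 1)
  have hf : ∀ ν, coeff ν f = ∑ w : Equiv.Perm (Fin N),
      if Finsupp.mapDomain w μ = ν then 1 else 0 := fun ν => by
    simp only [f, rename_monomial, coeff_sum, coeff_monomial]
  refine ⟨⟨f, fun w => ?_, fun ν hν => ?_⟩, ?_⟩
  · simp only [f, map_sum, rename_rename]
    exact Equiv.sum_comp (Equiv.mulLeft w) fun w => rename w (monomial μ (1 : ℂ))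
  · rw [hf]
    refine sum_eq_zero fun w _ => if_neg fun h => ?_
    exact absurd (toDegLex_mapDomain_le μ hμ w) (by rw [h]; exact not_le.mpr hν)
  · rw [hf, sum_boole, Nat.cast_ne_zero]
    exact (card_pos.mpr ⟨1, by simp⟩).ne'

/-- Joint eigenfunctions of the Ruijsenaars operators among symmetric polynomials. -/
theorem exists_eigenpolynomial {k p : ℂ} (hk : k ≠ 0) (hp : p ≠ 0) (hp1 : p ≠ 1)
    (hp2 : p ^ 2 ≠ 1) (μ : Fin N →₀ ℕ) (hμ : Antitone μ) :
    ∃ f : MvPolynomial (Fin N) ℂ, f ≠ 0 ∧ f.IsSymmetric ∧ ∀ i ≤ N, ∀ t, Function.Injective t →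
      ruij k p i (fun t => eval t f) t =
        (∑ I ∈ powersetCard i univ, ∏ r ∈ I, (p ^ μ r * k ^ deltaVec N r)) * eval t f := by
  choose L hL1 hL2 using fun i : Fin (N + 1) => exists_ruij_linearMap hk p i μ
  obtain ⟨f₀, hf₀⟩ := exists_coeff_ne_zero μ hμ
  let ℓ : Module.Dual ℂ (symmetricLE μ) := (lcoeff ℂ μ).comp (symmetricLE μ).subtype
  have hcomm : ∀ i j, Commute (L i) (L j) := fun i j => by
    refine LinearMap.ext fun f => Subtype.ext (eq_of_eval_eq_of_generic p fun t ht => ?_)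
    rw [Module.End.mul_apply, Module.End.mul_apply, hL1 _ _ t ht.injective,
      hL1 _ _ t ht.injective, ruij_congr hp _ (hL1 j f) ht, ruij_congr hp _ (hL1 i f) ht]
    exact ruij_comm hk hp hp1 hp2 t ht i j _
  obtain ⟨f, hf0, hf⟩ := exists_joint_eigenvector L hcomm ℓ
    (fun h => hf₀ (DFunLike.congr_fun h f₀)) _ hL2
  refine ⟨f, fun h => hf0 (Subtype.ext h), (mem_symmetricLE.mp f.2).1, fun i hi t ht => ?_⟩
  have h := congrArg (fun g : symmetricLE μ => eval t (g : MvPolynomial (Fin N) ℂ))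
    (hf ⟨i, Nat.lt_succ_of_le hi⟩)
  simp only [hL1 _ f t ht, Submodule.coe_smul, smul_eval] at h
  exact h

end PolynomialOperator

section Interpolation

variable {N : ℕ}

/-- The point `(p^{μ_1} k^{δ_1}, …, p^{μ_N} k^{δ_N})`. -/
noncomputable def spectralPoint (k p : ℂ) (μ : Fin N → ℕ) (r : Fin N) : ℂ :=
  p ^ μ r * k ^ deltaVec N r

theorem zpow_mul_zpow_ne {k p : ℂ} (hk : k ≠ 0) (hp : p ≠ 0)
    (hG : ∀ j : ℕ, 1 ≤ j → j ≤ N → ∀ m : ℤ, k ^ (2 * j) ≠ p ^ m) {a b : ℕ} {u v : ℤ} {j : ℕ}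
    (h1 : 1 ≤ j) (hj : j ≤ N) (huv : u - v = 2 * j) : p ^ a * k ^ u ≠ p ^ b * k ^ v := by
  intro h
  refine hG j h1 hj (b - a) ?_
  rw [← zpow_natCast, zpow_sub₀ hp, show ((2 * j : ℕ) : ℤ) = u - v by push_cast; omega,
    zpow_sub₀ hk, div_eq_div_iff (zpow_ne_zero _ hk) (zpow_ne_zero _ hp), zpow_natCast,
    zpow_natCast, mul_comm, h]

theorem spectralPoint_injective {k p : ℂ} (hk : k ≠ 0) (hp : p ≠ 0)
    (hG : ∀ j : ℕ, 1 ≤ j → j ≤ N → ∀ m : ℤ, k ^ (2 * j) ≠ p ^ m) (μ : Fin N → ℕ) :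
    Function.Injective (spectralPoint k p μ) := by
  have h : ∀ r s : Fin N, r < s → spectralPoint k p μ r ≠ spectralPoint k p μ s := by
    intro r s hrs
    have hrs' : (r : ℕ) < s := hrs
    have hs := s.2
    refine zpow_mul_zpow_ne hk hp hG (j := s - r) (by omega) (by omega) ?_
    rw [deltaVec, deltaVec]
    omega
  intro r s hrs
  by_contra hne
  rcases lt_or_gt_of_ne hne with h1 | h1
  exacts [h r s h1 hrs, h s r h1 hrs.symm]

theorem shift_spectralPoint (k p : ℂ) (μ : Fin N → ℕ) (I : Finset (Fin N)) :
    shift p I (spectralPoint k p μ) =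
      spectralPoint k p (fun r => μ r + if r ∈ I then 1 else 0) := by
  ext r
  simp only [shift, spectralPoint]
  split_ifs
  · rw [pow_succ]; ring
  · rw [add_zero]

theorem ruijCoeff_spectralPoint_eq_zero {k p : ℂ} (hk : k ≠ 0) {μ : Fin N → ℕ} (hμ : Antitone μ)
    {I : Finset (Fin N)} (hI : ¬ Antitone fun r => μ r + if r ∈ I then 1 else 0) :
    ruijCoeff k (spectralPoint k p μ) I = 0 := by
  rcases N with _ | n
  · exact absurd (fun r => r.elim0) hI
  rw [Fin.antitone_iff_succ_le, not_forall] at hI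
  obtain ⟨i, hi⟩ := hI
  have hle := hμ (Fin.castSucc_lt_succ (i := i)).le
  have h1 : i.succ ∈ I := by
    by_contra h
    simp only [h, if_false] at hi
    omega
  have h2 : i.castSucc ∉ I := by
    intro h
    simp only [h, h1, if_true] at hi
    omega
  have h3 : μ i.succ = μ i.castSucc := by
    simp only [h1, h2, if_true, if_false] at hi
    omega
  refine prod_eq_zero h1 (prod_eq_zero (mem_compl.mpr h2) ?_)
  have h4 : k * k ^ deltaVec (n + 1) i.succ = k⁻¹ * k ^ deltaVec (n + 1) i.castSucc := by
    rw [← zpow_one_add₀ hk, ← zpow_neg_one, ← zpow_add₀ hk]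
    congr 1
    simp only [deltaVec, Fin.val_succ, Fin.val_castSucc]
    push_cast
    ring
  rw [spectralPoint, spectralPoint, h3, mul_left_comm, h4, mul_left_comm, sub_self, zero_div]

theorem ruijCoeff_spectralPoint_ne_zero {k p : ℂ} (hk : k ≠ 0) (hp : p ≠ 0)
    (hG : ∀ j : ℕ, 1 ≤ j → j ≤ N → ∀ m : ℤ, k ^ (2 * j) ≠ p ^ m) (μ : Fin N → ℕ)
    {I : Finset (Fin N)} (hI : ∀ r ∈ I, ∀ s ∉ I, r < s) :
    ruijCoeff k (spectralPoint k p μ) I ≠ 0 := by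
  refine prod_ne_zero_iff.mpr fun r hr => prod_ne_zero_iff.mpr fun s hs => ?_
  have hlt := hI r hr s (mem_compl.mp hs)
  refine div_ne_zero (sub_ne_zero.mpr ?_)
    (sub_ne_zero.mpr ((spectralPoint_injective hk hp hG μ).ne hlt.ne))
  have hlt' : (r : ℕ) < s := hlt
  have hs := s.2
  rw [spectralPoint, spectralPoint, mul_left_comm, ← zpow_one_add₀ hk, mul_left_comm,
    ← zpow_neg_one, ← zpow_add₀ hk]
  refine zpow_mul_zpow_ne hk hp hG (j := s - r + 1) (by omega) (by omega) ?_
  rw [deltaVec, deltaVec]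
  omega

theorem sum_weight_lt {I J : Finset (Fin N)} (hI : ∀ r ∈ I, ∀ s ∉ I, r < s) (hcard : #J = #I)
    (hne : J ≠ I) : ∑ r ∈ J, (N - r : ℕ) < ∑ r ∈ I, (N - r : ℕ) := by
  have hcard' : #(J \ I) = #(I \ J) := card_sdiff_comm hcard
  have hpos : (J \ I).Nonempty := by
    rw [nonempty_iff_ne_empty, Ne, sdiff_eq_empty_iff_subset]
    exact fun h => hne (eq_of_subset_of_card_le h hcard.ge)
  rw [← sum_sdiff (inter_subset_left : I ∩ J ⊆ I), ← sum_sdiff (inter_subset_left : J ∩ I ⊆ J),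
    sdiff_inter_self_left, sdiff_inter_self_left, inter_comm J I, add_lt_add_iff_right]
  obtain ⟨e⟩ : Nonempty ((J \ I : Finset (Fin N)) ≃ (I \ J : Finset (Fin N))) :=
    ⟨equivOfCardEq hcard'⟩
  rw [← sum_coe_sort (J \ I), ← sum_coe_sort (I \ J), ← Equiv.sum_comp e]
  have := hpos.to_subtype
  refine sum_lt_sum_of_nonempty univ_nonempty fun x _ => ?_
  have h := hI (e x) (mem_sdiff.mp (e x).2).1 x (mem_sdiff.mp x.2).2
  have h' : ((e x : Fin N) : ℕ) < (x : Fin N) := h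
  have := (x : Fin N).2
  omega

/-- A joint eigenfunction vanishing at `k^δ` vanishes at all spectral points. -/
theorem eigenfunction_vanishes {k p : ℂ} (hk : k ≠ 0) (hp : p ≠ 0)
    (hG : ∀ j : ℕ, 1 ≤ j → j ≤ N → ∀ m : ℤ, k ^ (2 * j) ≠ p ^ m) {F : (Fin N → ℂ) → ℂ}
    {e : ℕ → ℂ} (hF : ∀ i, 1 ≤ i → i ≤ N → ∀ t, (∀ r, t r ≠ 0) → Function.Injective t →
      ruij k p i F t = e i * F t) (h0 : F (fun r => k ^ deltaVec N r) = 0)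
    (μ : Fin N → ℕ) (hμ : Antitone μ) : F (spectralPoint k p μ) = 0 := by
  induction hn : ∑ r : Fin N, (N - r : ℕ) * μ r using Nat.strong_induction_on generalizing μ with
  | _ n ih =>
  by_cases hμ0 : μ = 0
  · rw [← h0, hμ0]
    congr 1
    ext r
    simp [spectralPoint]
  let I₀ : Finset (Fin N) := {r | 0 < μ r}
  have hI₀ : ∀ r ∈ I₀, ∀ s ∉ I₀, r < s := by
    intro r hr s hs
    simp only [I₀, mem_filter, mem_univ, true_and] at hr hs
    exact lt_of_not_ge fun h => hs (hr.trans_le (hμ h))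
  have hne : I₀.Nonempty := by
    obtain ⟨r, hr⟩ := Function.ne_iff.mp hμ0
    exact ⟨r, mem_filter.mpr ⟨mem_univ r, Nat.pos_of_ne_zero hr⟩⟩
  let ν : Fin N → ℕ := fun r => μ r - 1
  have hν : Antitone ν := fun r s hrs => Nat.sub_le_sub_right (hμ hrs) 1
  have hμν : (fun r => ν r + if r ∈ I₀ then 1 else 0) = μ := by
    ext r
    simp only [ν, I₀, mem_filter, mem_univ, true_and]
    split_ifs <;> omega
  have hweight : ∀ I : Finset (Fin N), ∑ r : Fin N, (N - r : ℕ) * (ν r + if r ∈ I then 1 else 0) =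
      ∑ r : Fin N, (N - r : ℕ) * ν r + ∑ r ∈ I, (N - r : ℕ) := by
    intro I
    simp only [mul_add, sum_add_distrib, mul_ite, mul_one, mul_zero, Fintype.sum_ite_mem]
  have hwμ := hweight I₀
  rw [congrArg (fun f : Fin N → ℕ => ∑ r : Fin N, (N - r : ℕ) * f r) hμν, hn] at hwμ
  have hFν : F (spectralPoint k p ν) = 0 := by
    refine ih _ ?_ ν hν rfl
    rw [hwμ]
    refine Nat.lt_add_of_pos_right (sum_pos (fun r _ => ?_) hne)
    have := r.2
    omega
  have heq := hF #I₀ hne.card_pos (by simpa using card_le_univ I₀) (spectralPoint k p ν)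
    (fun r => mul_ne_zero (pow_ne_zero _ hp) (zpow_ne_zero _ hk))
    (spectralPoint_injective hk hp hG ν)
  rw [hFν, mul_zero, ruij, sum_eq_single_of_mem I₀ (by simp [mem_powersetCard]),
    shift_spectralPoint, hμν] at heq
  · exact (mul_eq_zero.mp heq).resolve_left (ruijCoeff_spectralPoint_ne_zero hk hp hG ν hI₀)
  · intro I hI hne'
    rw [shift_spectralPoint]
    by_cases hant : Antitone fun r => ν r + if r ∈ I then 1 else 0
    · rw [ih _ ?_ _ hant rfl, mul_zero]
      rw [hweight, hwμ]
      exact Nat.add_lt_add_left (sum_weight_lt hI₀ (mem_powersetCard.mp hI).2 hne') _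
    · rw [ruijCoeff_spectralPoint_eq_zero hk hν hant, zero_mul]

/-- The dominant cone. -/
def dominant (N : ℕ) : AddSubmonoid (Fin N → ℕ) where
  carrier := {μ | Antitone μ}
  zero_mem' := antitone_const
  add_mem' h h' := Antitone.add h h'

/-- The character `μ ↦ p^{⟨μ, ν⟩}` of the dominant cone. -/
noncomputable def dominantChar (p : ℂ) (ν : Fin N → ℤ) : Multiplicative (dominant N) →* ℂ where
  toFun μ := ∏ r, (p ^ (μ.toAdd : Fin N → ℕ) r) ^ ν r
  map_one' := by simp
  map_mul' μ μ' := by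
    simp [pow_add, mul_zpow, prod_mul_distrib]

theorem dominantChar_injective {p : ℂ} (hp : p ≠ 0)
    (hpz : Function.Injective fun n : ℤ => p ^ n) :
    Function.Injective (dominantChar (N := N) p) := by
  intro ν ν' h
  have hsum : ∀ j, ∑ r ∈ Iic j, ν r = ∑ r ∈ Iic j, ν' r := by
    intro j
    have hanti : (fun r => if r ∈ Iic j then 1 else 0) ∈ dominant N := by
      intro r s hrs
      simp only [mem_Iic]
      split_ifs with h1 h2
      exacts [le_rfl, absurd (hrs.trans h1) h2, zero_le_one, le_rfl]
    have hval : ∀ η : Fin N → ℤ, dominantChar p η (Multiplicative.ofAdd ⟨_, hanti⟩) =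
        p ^ ∑ r ∈ Iic j, η r := by
      intro η
      simp only [dominantChar, MonoidHom.coe_mk, OneHom.coe_mk, toAdd_ofAdd]
      have hz : ∀ s : Finset (Fin N), p ^ ∑ r ∈ s, η r = ∏ r ∈ s, p ^ η r := by
        intro s
        induction s using Finset.induction_on with
        | empty => simp
        | insert a s ha ih => rw [sum_insert ha, zpow_add₀ hp, prod_insert ha, ih]
      rw [hz, ← prod_subset (subset_univ (Iic j)) (fun r _ hr => by simp only [hr]; simp)]
      exact prod_congr rfl fun r hr => by simp only [hr]; simp
    have h' := DFunLike.congr_fun h (Multiplicative.ofAdd ⟨_, hanti⟩)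
    rw [hval, hval] at h'
    exact hpz h'
  ext j
  induction j using WellFoundedLT.induction with
  | _ j ih =>
  have hj := hsum j
  rw [← Iio_insert, sum_insert notMem_Iio_self, sum_insert notMem_Iio_self,
    sum_congr rfl fun r hr => ih r (mem_Iio.mp hr)] at hj
  exact add_right_cancel hj

theorem eq_zero_of_evalL_spectralPoint {k p : ℂ} (hk : k ≠ 0) (hp : p ≠ 0)
    (hpz : Function.Injective fun n : ℤ => p ^ n) (c : (Fin N → ℤ) →₀ ℂ)
    (h : ∀ μ, Antitone μ → evalL N c (spectralPoint k p μ) = 0) : c = 0 := by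
  have hli := (linearIndependent_monoidHom (Multiplicative (dominant N)) ℂ).comp _
    (dominantChar_injective (N := N) hp hpz)
  rw [linearIndependent_iff'] at hli
  have hz := hli c.support (fun ν => c ν * ∏ r, (k ^ deltaVec N r) ^ ν r) (by
    ext μ
    simp only [Finset.sum_apply, Pi.smul_apply, Function.comp_apply, smul_eq_mul, Pi.zero_apply]
    rw [← h _ μ.toAdd.2, evalL]
    refine sum_congr rfl fun ν _ => ?_
    simp only [spectralPoint, mul_zpow, prod_mul_distrib, dominantChar, MonoidHom.coe_mk,
      OneHom.coe_mk]
    ring)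
  ext ν
  by_contra hν
  refine mul_ne_zero hν (prod_ne_zero_iff.mpr fun r _ => ?_) (hz ν (Finsupp.mem_support_iff.mpr hν))
  exact zpow_ne_zero _ (zpow_ne_zero _ hk)

end Interpolation

section Laurent

variable {N : ℕ}

theorem evalL_eq_linearCombination (c : (Fin N → ℤ) →₀ ℂ) (t : Fin N → ℂ) :
    evalL N c t = Finsupp.linearCombination ℂ (fun ν : Fin N → ℤ => ∏ i, t i ^ ν i) c :=
  rfl

/-- The Laurent polynomial `(t_1 ⋯ t_N)^{-b} f`. -/
noncomputable def laurentOf (b : ℤ) (f : MvPolynomial (Fin N) ℂ) : (Fin N → ℤ) →₀ ℂ :=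
  ∑ ν ∈ f.support, Finsupp.single (fun r => (ν r : ℤ) - b) (f.coeff ν)

theorem evalL_laurentOf (b : ℤ) (f : MvPolynomial (Fin N) ℂ) {t : Fin N → ℂ}
    (ht : ∀ r, t r ≠ 0) :
    evalL N (laurentOf b f) t = (∏ r, t r ^ (-b)) * MvPolynomial.eval t f := by
  rw [evalL_eq_linearCombination, laurentOf, map_sum, MvPolynomial.eval_eq', mul_sum]
  refine sum_congr rfl fun ν _ => ?_
  rw [Finsupp.linearCombination_single, smul_eq_mul, mul_left_comm, ← prod_mul_distrib]
  congr 1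
  refine prod_congr rfl fun r _ => ?_
  beta_reduce
  rw [sub_eq_neg_add, zpow_add₀ (ht r), zpow_natCast]

theorem laurentOf_ne_zero (b : ℤ) {f : MvPolynomial (Fin N) ℂ} (hf : f ≠ 0) :
    laurentOf b f ≠ 0 := by
  intro h
  have hX : (∏ r : Fin N, MvPolynomial.X r : MvPolynomial (Fin N) ℂ) ≠ 0 :=
    prod_ne_zero_iff.mpr fun r _ => MvPolynomial.X_ne_zero r
  refine mul_ne_zero hf hX (MvPolynomial.funext fun t => ?_)
  rw [map_mul, map_prod, map_zero]
  by_cases ht : ∀ r, t r ≠ 0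
  · have h1 := evalL_laurentOf b f ht
    rw [h, evalL_eq_linearCombination, map_zero, eq_comm] at h1
    rw [(mul_eq_zero.mp h1).resolve_left (prod_ne_zero_iff.mpr fun r _ => zpow_ne_zero _ (ht r)),
      zero_mul]
  · push Not at ht
    obtain ⟨r, hr⟩ := ht
    rw [prod_eq_zero (mem_univ r) (by rw [MvPolynomial.eval_X, hr]), mul_zero]

theorem ruij_prod_zpow_mul (k p : ℂ) (b : ℤ) (i : ℕ) (F : (Fin N → ℂ) → ℂ) (t : Fin N → ℂ) :
    ruij k p i (fun t => (∏ r, t r ^ b) * F t) t =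
      (p ^ b) ^ i * (∏ r, t r ^ b) * ruij k p i F t := by
  rw [ruij, ruij, mul_sum]
  refine sum_congr rfl fun I hI => ?_
  have h : ∏ r, shift p I t r ^ b = (p ^ b) ^ i * ∏ r, t r ^ b := by
    have h1 : ∀ r, shift p I t r ^ b = (if r ∈ I then p ^ b else 1) * t r ^ b := by
      intro r
      rw [shift]
      split_ifs
      · rw [mul_zpow]
      · rw [one_mul]
    rw [prod_congr rfl fun r _ => h1 r, prod_mul_distrib, Fintype.prod_ite_mem, prod_const,
      (mem_powersetCard.mp hI).2]
  rw [h]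
  ring

theorem ruij_congr_of_ne_zero {k p : ℂ} (hp : p ≠ 0) {F G : (Fin N → ℂ) → ℂ}
    (h : ∀ t, (∀ r, t r ≠ 0) → F t = G t) (i : ℕ) {t : Fin N → ℂ} (ht : ∀ r, t r ≠ 0) :
    ruij k p i F t = ruij k p i G t := by
  refine sum_congr rfl fun I _ => ?_
  rw [h]
  intro r
  rw [shift]
  split_ifs
  exacts [mul_ne_zero hp (ht r), ht r]

/-- `e_i(p^λ k^δ)`. -/
noncomputable def eigenvalue (k p : ℂ) (lam : Fin N → ℤ) (i : ℕ) : ℂ :=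
  ∑ I ∈ powersetCard i univ, ∏ r ∈ I, (p ^ lam r * k ^ deltaVec N r)

theorem exists_laurent_eigenfunction {k p : ℂ} (hk : k ≠ 0) (hp : p ≠ 0) (hp1 : p ≠ 1)
    (hp2 : p ^ 2 ≠ 1) (lam : Fin N → ℤ) (hlam : Antitone lam) :
    ∃ c : (Fin N → ℤ) →₀ ℂ, c ≠ 0 ∧
      (∀ (w : Equiv.Perm (Fin N)) (t : Fin N → ℂ), (∀ r, t r ≠ 0) →
        evalL N c (t ∘ w) = evalL N c t) ∧
      ∀ i ≤ N, ∀ t, (∀ r, t r ≠ 0) → Function.Injective t →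
        ruij k p i (evalL N c) t = eigenvalue k p lam i * evalL N c t := by
  obtain ⟨b, hb⟩ : ∃ b : ℤ, ∀ r, 0 ≤ lam r + b := by
    refine ⟨∑ r, |lam r|, fun r => ?_⟩
    have := single_le_sum (fun s _ => abs_nonneg (lam s)) (mem_univ r)
    have := neg_abs_le (lam r)
    omega
  let μ : Fin N →₀ ℕ := Finsupp.equivFunOnFinite.symm fun r => (lam r + b).toNat
  have hμ : Antitone μ := fun r s hrs => Int.toNat_le_toNat (by have := hlam hrs; omega)
  obtain ⟨f, hf0, hfs, hf⟩ := exists_eigenpolynomial hk hp hp1 hp2 μ hμ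
  refine ⟨laurentOf b f, laurentOf_ne_zero b hf0, fun w t ht => ?_, fun i hi t ht hti => ?_⟩
  · rw [evalL_laurentOf b f ht, evalL_laurentOf b f (t := t ∘ w) fun r => ht (w r),
      eval_comp_of_isSymmetric hfs]
    congr 1
    exact Equiv.prod_comp w fun r => t r ^ (-b)
  · rw [ruij_congr_of_ne_zero hp (fun t ht => evalL_laurentOf b f ht) i ht, ruij_prod_zpow_mul,
      hf i hi t hti, evalL_laurentOf b f ht]
    have h : eigenvalue k p lam i = (p ^ (-b)) ^ i *
        ∑ I ∈ powersetCard i univ, ∏ r ∈ I, (p ^ μ r * k ^ deltaVec N r) := by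
      rw [eigenvalue, mul_sum]
      refine sum_congr rfl fun I hI => ?_
      rw [← (mem_powersetCard.mp hI).2, ← prod_const, ← prod_mul_distrib]
      refine prod_congr rfl fun r _ => ?_
      rw [← mul_assoc, ← zpow_natCast, ← zpow_add₀ hp]
      congr 2
      have : ((μ r : ℕ) : ℤ) = lam r + b := Int.toNat_of_nonneg (hb r)
      omega
    rw [h]
    ring

theorem eq_zero_of_eigenfunction {k p : ℂ} (hk : k ≠ 0) (hp : p ≠ 0)
    (hpz : Function.Injective fun n : ℤ => p ^ n)
    (hG : ∀ j : ℕ, 1 ≤ j → j ≤ N → ∀ m : ℤ, k ^ (2 * j) ≠ p ^ m) {c : (Fin N → ℤ) →₀ ℂ}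
    {e : ℕ → ℂ} (hc : ∀ i, 1 ≤ i → i ≤ N → ∀ t, (∀ r, t r ≠ 0) → Function.Injective t →
      ruij k p i (evalL N c) t = e i * evalL N c t)
    (h0 : evalL N c (fun r => k ^ deltaVec N r) = 0) : c = 0 :=
  eq_zero_of_evalL_spectralPoint hk hp hpz c
    fun μ hμ => eigenfunction_vanishes hk hp hG hc h0 μ hμ

theorem apply_comp_of_evalL_comp {k p : ℂ} (hk : k ≠ 0) (hp : p ≠ 0)
    (hpz : Function.Injective fun n : ℤ => p ^ n) {c : (Fin N → ℤ) →₀ ℂ}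
    (hc : ∀ (w : Equiv.Perm (Fin N)) (t : Fin N → ℂ), (∀ r, t r ≠ 0) →
      evalL N c (t ∘ w) = evalL N c t) (w : Equiv.Perm (Fin N)) (ν : Fin N → ℤ) :
    c (ν ∘ w) = c ν := by
  have hinj : Function.Injective fun ν : Fin N → ℤ => ν ∘ w := w.surjective.injective_comp_right
  have h : c.mapDomain (fun ν => ν ∘ w) - c = 0 := by
    refine eq_zero_of_evalL_spectralPoint hk hp hpz _ fun μ _ => ?_
    have ht : ∀ r, spectralPoint k p μ r ≠ 0 :=
      fun r => mul_ne_zero (pow_ne_zero _ hp) (zpow_ne_zero _ hk)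
    rw [evalL_eq_linearCombination, map_sub, sub_eq_zero, ← evalL_eq_linearCombination,
      ← evalL_eq_linearCombination, ← hc w⁻¹ _ ht, evalL_eq_linearCombination,
      Finsupp.linearCombination_mapDomain, evalL_eq_linearCombination]
    congr 2
    ext ν
    rw [Function.comp_apply, ← Equiv.prod_comp w⁻¹]
    simp
  have h' := DFunLike.congr_fun (sub_eq_zero.mp h) (ν ∘ w)
  rw [← h']
  exact Finsupp.mapDomain_apply hinj c ν

theorem ruij_smul (k p a : ℂ) (i : ℕ) (F : (Fin N → ℂ) → ℂ) (t : Fin N → ℂ) :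
    ruij k p i (fun t => a * F t) t = a * ruij k p i F t := by
  rw [ruij, ruij, mul_sum]
  exact sum_congr rfl fun I _ => mul_left_comm _ _ _

theorem ruij_sub (k p : ℂ) (i : ℕ) (F G : (Fin N → ℂ) → ℂ) (t : Fin N → ℂ) :
    ruij k p i (fun t => F t - G t) t = ruij k p i F t - ruij k p i G t := by
  simp only [ruij, mul_sub, sum_sub_distrib]

theorem existsUnique_laurent_eigenfunction {k p : ℂ} (hk : k ≠ 0) (hp : p ≠ 0)
    (hpz : Function.Injective fun n : ℤ => p ^ n)
    (hG : ∀ j : ℕ, 1 ≤ j → j ≤ N → ∀ m : ℤ, k ^ (2 * j) ≠ p ^ m) (lam : Fin N → ℤ)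
    (hlam : Antitone lam) :
    ∃! c : (Fin N → ℤ) →₀ ℂ, (∀ (w : Equiv.Perm (Fin N)) (ν : Fin N → ℤ), c (ν ∘ w) = c ν) ∧
      evalL N c (fun i => k ^ deltaVec N i) = 1 ∧
      ∀ i, 1 ≤ i → i ≤ N → ∀ t, (∀ r, t r ≠ 0) → Function.Injective t →
        ruij k p i (evalL N c) t = eigenvalue k p lam i * evalL N c t := by
  have hp1 : p ≠ 1 := fun h => one_ne_zero (hpz (a₁ := 1) (a₂ := 0) (by simp [h]))
  have hp2 : p ^ 2 ≠ 1 := fun h => two_ne_zero (hpz (a₁ := 2) (a₂ := 0) (by simpa using h))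
  have hsmul : ∀ (a : ℂ) (c : (Fin N → ℤ) →₀ ℂ), evalL N (a • c) = fun t => a * evalL N c t := by
    intro a c
    ext t
    rw [evalL_eq_linearCombination, map_smul, smul_eq_mul, evalL_eq_linearCombination]
  have hsub : ∀ c c' : (Fin N → ℤ) →₀ ℂ,
      evalL N (c - c') = fun t => evalL N c t - evalL N c' t := by
    intro c c'
    ext t
    rw [evalL_eq_linearCombination, map_sub, evalL_eq_linearCombination,
      evalL_eq_linearCombination]
  obtain ⟨c, hc0, hcw, hc⟩ := exists_laurent_eigenfunction hk hp hp1 hp2 lam hlam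
  have hne : evalL N c (fun r => k ^ deltaVec N r) ≠ 0 := fun h =>
    hc0 (eq_zero_of_eigenfunction hk hp hpz hG (fun i _ hi => hc i hi) h)
  refine ⟨(evalL N c fun r => k ^ deltaVec N r)⁻¹ • c, ⟨fun w ν => ?_, ?_, ?_⟩, ?_⟩
  · rw [Finsupp.smul_apply, Finsupp.smul_apply, apply_comp_of_evalL_comp hk hp hpz hcw]
  · rw [hsmul]
    exact inv_mul_cancel₀ hne
  · intro i _ hi t ht hti
    rw [hsmul, ruij_smul, hc i hi t ht hti, mul_left_comm]
  · rintro c' ⟨-, h1', hc'⟩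
    rw [← sub_eq_zero]
    refine eq_zero_of_eigenfunction hk hp hpz hG (e := eigenvalue k p lam) ?_ ?_
    · intro i hi1 hi t ht hti
      rw [hsub, ruij_sub, hc' i hi1 hi t ht hti, hsmul, ruij_smul, hc i hi t ht hti]
      ring
    · rw [hsub, hsmul]
      beta_reduce
      rw [h1', inv_mul_cancel₀ hne, sub_self]

end Laurent

end Auxiliary

/-- For generic `k` and every partition `λ ∈ Λ` (a weakly decreasing `N`-tuple of integers)
there is a unique `S_N`-invariant Laurent polynomial `E_λ` (the normalized symmetric
Macdonald polynomial) with `E_λ(k^δ) = 1` and `L_i E_λ = e_i(q^{-λ}k^δ) E_λ` for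
`1 ≤ i ≤ N`, where `L_i` is the `i`-th Ruijsenaars (Macdonald) `q`-difference operator;
the eigenvalue equations are identities of rational functions, i.e. they hold at every
point `t` with nonzero, pairwise distinct coordinates.  The Laurent polynomial is
recorded through its finitely supported coefficient function `c`; `S_N`-invariance means
`c(ν ∘ w) = c(ν)` for all `w ∈ S_N`. -/
theorem macdonald_polynomials (N : ℕ) (hN : 2 ≤ N) (q : ℝ) (hq0 : 0 < q) (hq1 : q < 1)
    (k : ℂ) (hk : k ≠ 0) (hgen : IsGeneric N q k)
    (lam : Fin N → ℤ) (hlam : ∀ i j : Fin N, i ≤ j → lam j ≤ lam i) :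
    ∃! c : (Fin N → ℤ) →₀ ℂ,
      (∀ (w : Equiv.Perm (Fin N)) (ν : Fin N → ℤ), c (ν ∘ w) = c ν) ∧
      evalL N c (fun i => k ^ deltaVec N i) = 1 ∧
      (∀ i : ℕ, 1 ≤ i → i ≤ N →
        ∀ t : Fin N → ℂ, (∀ r, t r ≠ 0) → (∀ r s : Fin N, r ≠ s → t r ≠ t s) →
          ∑ I ∈ Finset.powersetCard i (Finset.univ : Finset (Fin N)),
            (∏ r ∈ I, ∏ s ∈ Iᶜ, (k * t r - k⁻¹ * t s) / (t r - t s)) *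
              evalL N c (fun r => if r ∈ I then (q : ℂ)⁻¹ * t r else t r) =
          (∑ I ∈ Finset.powersetCard i (Finset.univ : Finset (Fin N)),
              ∏ r ∈ I, ((q : ℂ) ^ (-lam r) * k ^ deltaVec N r)) *
            evalL N c t) := by
  have hq : (q : ℂ) ≠ 0 := Complex.ofReal_ne_zero.mpr hq0.ne'
  have hpz : Function.Injective fun n : ℤ => (q : ℂ)⁻¹ ^ n := by
    intro m n h
    have h' : q ^ m = q ^ n := by
      have h'' : ((q : ℂ) ^ m)⁻¹ = ((q : ℂ) ^ n)⁻¹ := by simpa only [inv_zpow] using h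
      exact_mod_cast inv_injective h''
    exact zpow_right_injective₀ hq0 hq1.ne h'
  have hG : ∀ j : ℕ, 1 ≤ j → j ≤ N → ∀ m : ℤ, k ^ (2 * j) ≠ (q : ℂ)⁻¹ ^ m := by
    intro j h1 hj m
    rw [inv_zpow']
    exact hgen.1 j h1 hj _
  have hev : ∀ i, eigenvalue k (q : ℂ)⁻¹ lam i =
      ∑ I ∈ Finset.powersetCard i (Finset.univ : Finset (Fin N)),
        ∏ r ∈ I, ((q : ℂ) ^ (-lam r) * k ^ deltaVec N r) := by
    intro i
    simp only [eigenvalue, inv_zpow']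
  obtain ⟨c, ⟨h1, h2, h3⟩, huniq⟩ :=
    existsUnique_laurent_eigenfunction hk (inv_ne_zero hq) hpz hG lam fun i j => hlam i j
  have hinj : ∀ t : Fin N → ℂ, (∀ r s : Fin N, r ≠ s → t r ≠ t s) ↔ Function.Injective t :=
    fun t => ⟨fun h r s hrs => by_contra fun hne => h r s hne hrs, fun h _ _ hne => h.ne hne⟩
  refine ⟨c, ⟨h1, h2, fun i hi1 hi t ht hti => ?_⟩, fun c' h' => huniq c' ⟨h'.1, h'.2.1, ?_⟩⟩
  · rw [← hev]
    exact h3 i hi1 hi t ht ((hinj t).mp hti)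
  · intro i hi1 hi t ht hti
    rw [hev]
    exact h'.2.2 i hi1 hi t ht ((hinj t).mpr hti)
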